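/- arXiv:0711.5005 — 2 statements merged into one kernel-verified Lean document; each statement's English description precedes it below -/
import Mathlib

section
/- For every constant A > 0 there exists a constant C > 0 (depending only on A) with the following property. Let s < t be real numbers and let f : ℝ → ℝ be three times continuously differentiable on [s,t] with f' continuous and strictly increasing on [s,t]. Let λ₂, λ₃ > 0 satisfy λ₂ < |f''(x)| < Aλ₂ and |f'''(x)| < Aλ₃ for all x ∈ [s,t]. For each integer m with f'(s) ≤ m ≤ f'(t), let x_m ∈ [s,t] satisfy f'(x_m) = m. Then |Σ_{k ∈ ℤ, s ≤ k ≤ t} e^{2πi f(k)} − e^{iπ/4} Σ_{m ∈ ℤ, f'(s) ≤ m ≤ f'(t)} e^{2πi(f(x_m) − m x_m)} / √(|f''(x_m)|)| ≤ C·(λ₂^{−1/2} + log(2 + (t−s)λ₂) + (t−s)·λ₂^{1/5}·λ₃^{1/5}). -/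
namespace VanDerCorput

open MeasureTheory Filter Topology

/-- The oscillating factor `e(x) = exp(2πix)`. -/
noncomputable def osc (x : ℝ) : ℂ := Complex.exp (2 * Real.pi * Complex.I * (x : ℂ))

lemma osc_eq (x : ℝ) : osc x = Complex.exp (Complex.I * ((2 * Real.pi * x : ℝ) : ℂ)) := by
  rw [osc]; congr 1; push_cast; ring

@[simp] lemma norm_osc (x : ℝ) : ‖osc x‖ = 1 := by
  rw [osc_eq, mul_comm, Complex.norm_exp_ofReal_mul_I]

lemma osc_add (x y : ℝ) : osc (x + y) = osc x * osc y := by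
  rw [osc, osc, osc, ← Complex.exp_add]; congr 1; push_cast; ring

@[simp] lemma osc_zero : osc 0 = 1 := by simp [osc]

@[fun_prop] lemma continuous_osc : Continuous osc := by unfold osc; fun_prop

lemma norm_osc_sub_osc_le (x y : ℝ) : ‖osc x - osc y‖ ≤ 2 * Real.pi * |x - y| := by
  have h : osc x - osc y = osc y * (osc (x - y) - 1) := by
    rw [mul_sub, ← osc_add]; simp
  rw [h, norm_mul, norm_osc, one_mul, osc_eq]
  refine Real.norm_exp_I_mul_ofReal_sub_one_le.trans (le_of_eq ?_)
  rw [Real.norm_eq_abs, abs_mul, abs_of_pos Real.two_pi_pos]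

lemma HasDerivAt.osc {F : ℝ → ℝ} {F' x : ℝ} (h : HasDerivAt F F' x) :
    HasDerivAt (fun y => osc (F y)) (2 * Real.pi * Complex.I * F' * osc (F x)) x := by
  have h1 := ((h.ofReal_comp).const_mul (2 * Real.pi * Complex.I)).cexp
  convert! h1 using 1
  rw [VanDerCorput.osc]; ring

lemma norm_intervalIntegral_osc_le {F : ℝ → ℝ} {p q : ℝ} (h : p ≤ q) :
    ‖∫ x in p..q, osc (F x)‖ ≤ q - p := by
  refine (intervalIntegral.norm_integral_le_of_norm_le_const (C := 1) fun x _ => ?_).trans ?_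
  · simp
  · rw [one_mul, abs_of_nonneg (by linarith)]

/-- A twice continuously differentiable phase `F` with derivatives `F₁`, `F₂`
and `F₂ ≥ l > 0` on the whole line. -/
structure IsPhase (F F₁ F₂ : ℝ → ℝ) (l : ℝ) : Prop where
  pos : 0 < l
  deriv : ∀ x, HasDerivAt F (F₁ x) x
  deriv₁ : ∀ x, HasDerivAt F₁ (F₂ x) x
  cont : Continuous F₂
  le : ∀ x, l ≤ F₂ x

namespace IsPhase

variable {F F₁ F₂ : ℝ → ℝ} {l : ℝ}

lemma continuous (h : IsPhase F F₁ F₂ l) : Continuous F :=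
  continuous_iff_continuousAt.2 fun x => (h.deriv x).continuousAt

lemma continuous₁ (h : IsPhase F F₁ F₂ l) : Continuous F₁ :=
  continuous_iff_continuousAt.2 fun x => (h.deriv₁ x).continuousAt

lemma reflect (h : IsPhase F F₁ F₂ l) :
    IsPhase (fun x => F (-x)) (fun x => -F₁ (-x)) (fun x => F₂ (-x)) l where
  pos := h.pos
  deriv x := by
    convert! (h.deriv (-x)).scomp x (hasDerivAt_neg x) using 1
    simp
  deriv₁ x := by
    convert! ((h.deriv₁ (-x)).scomp x (hasDerivAt_neg x)).neg using 1
    simp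
  cont := h.cont.comp continuous_neg
  le x := h.le _

lemma sub_linear (h : IsPhase F F₁ F₂ l) (a : ℝ) :
    IsPhase (fun x => F x - a * x) (fun x => F₁ x - a) F₂ l where
  pos := h.pos
  deriv x := by
    convert! (h.deriv x).sub ((hasDerivAt_id x).const_mul a) using 1
    simp
  deriv₁ x := (h.deriv₁ x).sub_const a
  cont := h.cont
  le := h.le

lemma mul_sub_le (h : IsPhase F F₁ F₂ l) {x y : ℝ} (hxy : x ≤ y) :
    l * (y - x) ≤ F₁ y - F₁ x := by
  have hd : Differentiable ℝ F₁ := fun x => (h.deriv₁ x).differentiableAt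
  refine mul_sub_le_image_sub_of_le_deriv hd (fun z => ?_) hxy
  rw [(h.deriv₁ z).deriv]; exact h.le z

lemma monotone (h : IsPhase F F₁ F₂ l) : Monotone F₁ := fun x y hxy => by
  have := h.mul_sub_le hxy
  have := mul_nonneg h.pos.le (sub_nonneg.2 hxy)
  linarith

lemma continuous_osc_comp (h : IsPhase F F₁ F₂ l) : Continuous fun x => osc (F x) :=
  continuous_osc.comp h.continuous

lemma intervalIntegrable (h : IsPhase F F₁ F₂ l) (p q : ℝ) :
    IntervalIntegrable (fun x => osc (F x)) volume p q :=
  h.continuous_osc_comp.intervalIntegrable _ _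

lemma integral_reflect (p q : ℝ) :
    ∫ x in (-q)..(-p), osc (F (-x)) = ∫ x in p..q, osc (F x) := by
  simpa using intervalIntegral.integral_comp_neg (a := -q) (b := -p) (fun x => osc (F x))

/-- Integration by parts away from the saddle point. -/
lemma norm_integral_sub_boundary_le (h : IsPhase F F₁ F₂ l) {p q : ℝ} (hpq : p ≤ q)
    (h0 : ∀ x ∈ Set.Icc p q, F₁ x ≠ 0) :
    ‖(∫ x in p..q, osc (F x)) -
      (osc (F q) / (2 * Real.pi * Complex.I * F₁ q) -
        osc (F p) / (2 * Real.pi * Complex.I * F₁ p))‖ ≤ 1 / F₁ p - 1 / F₁ q := by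
  have hpi : (2 * Real.pi * Complex.I : ℂ) ≠ 0 := Complex.two_pi_I_ne_zero
  have hcF : ContinuousOn (fun x => (F₁ x : ℂ)) (Set.Icc p q) :=
    (Complex.continuous_ofReal.comp h.continuous₁).continuousOn
  have hF0 : ∀ x ∈ Set.Icc p q, (F₁ x : ℂ) ≠ 0 := fun x hx => by exact_mod_cast h0 x hx
  have hd : ∀ x ∈ Set.uIcc p q,
      HasDerivAt (fun y => osc (F y) / (2 * Real.pi * Complex.I * F₁ y))
        (osc (F x) - osc (F x) * F₂ x / (2 * Real.pi * Complex.I * F₁ x ^ 2)) x := by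
    intro x hx
    rw [Set.uIcc_of_le hpq] at hx
    have hx0 := hF0 x hx
    have h2 := ((h.deriv₁ x).ofReal_comp).const_mul (2 * Real.pi * Complex.I)
    convert! (HasDerivAt.osc (h.deriv x)).div h2 (mul_ne_zero hpi hx0) using 1
    field_simp
  have hc2 : ContinuousOn
      (fun x => osc (F x) * F₂ x / (2 * Real.pi * Complex.I * F₁ x ^ 2)) (Set.Icc p q) := by
    refine ContinuousOn.div ?_ (continuousOn_const.mul (hcF.pow 2)) fun x hx =>
      mul_ne_zero hpi (pow_ne_zero 2 (hF0 x hx))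
    exact (h.continuous_osc_comp.mul (Complex.continuous_ofReal.comp h.cont)).continuousOn
  have hi2 := hc2.intervalIntegrable_of_Icc (μ := volume) hpq
  have hint := intervalIntegral.integral_eq_sub_of_hasDerivAt hd
    ((h.intervalIntegrable p q).sub hi2)
  rw [intervalIntegral.integral_sub (h.intervalIntegrable p q) hi2] at hint
  rw [← hint, sub_sub_cancel]
  have hd2 : ∀ x ∈ Set.uIcc p q, HasDerivAt (fun y => -(F₁ y)⁻¹) (F₂ x / F₁ x ^ 2) x := by
    intro x hx
    rw [Set.uIcc_of_le hpq] at hx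
    convert! ((h.deriv₁ x).inv (h0 x hx)).neg using 1
    ring
  have hi3 : IntervalIntegrable (fun x => F₂ x / F₁ x ^ 2) volume p q := by
    refine ContinuousOn.intervalIntegrable_of_Icc hpq ?_
    exact h.cont.continuousOn.div (h.continuous₁.continuousOn.pow 2) fun x hx =>
      pow_ne_zero 2 (h0 x hx)
  have hint2 := intervalIntegral.integral_eq_sub_of_hasDerivAt hd2 hi3
  have : 1 / F₁ p - 1 / F₁ q = ∫ x in p..q, F₂ x / F₁ x ^ 2 := by rw [hint2]; ring
  rw [this]
  refine intervalIntegral.norm_integral_le_of_norm_le hpq (ae_of_all _ fun x hx => ?_) hi3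
  have hx0 := h0 x (Set.Ioc_subset_Icc_self hx)
  have hF2 : 0 ≤ F₂ x := h.pos.le.trans (h.le x)
  simp only [norm_div, norm_mul, norm_osc, norm_pow, Complex.norm_I, Complex.norm_real,
    Real.norm_eq_abs, sq_abs, abs_of_nonneg hF2, abs_of_pos Real.pi_pos, Complex.norm_ofNat]
  rw [one_mul, mul_one]
  have : 0 < F₁ x ^ 2 := by positivity
  gcongr
  nlinarith [Real.pi_gt_three]

lemma norm_boundary_term {a y : ℝ} :
    ‖osc a / (2 * Real.pi * Complex.I * y)‖ ≤ 1 / (2 * |y|) := by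
  rw [norm_div, norm_osc]
  simp only [norm_mul, Complex.norm_I, Complex.norm_real, Real.norm_eq_abs,
    abs_of_pos Real.pi_pos, Complex.norm_ofNat, mul_one]
  rcases eq_or_ne y 0 with rfl | hy
  · simp
  have : 0 < |y| := abs_pos.2 hy
  gcongr
  nlinarith [Real.pi_gt_three]

/-- First derivative test. -/
lemma norm_integral_le_of_pos (h : IsPhase F F₁ F₂ l) {p q : ℝ} (hpq : p ≤ q)
    (h0 : 0 < F₁ p) : ‖∫ x in p..q, osc (F x)‖ ≤ 2 / F₁ p := by
  have hmono : ∀ x ∈ Set.Icc p q, 0 < F₁ x := fun x hx => h0.trans_le (h.monotone hx.1)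
  have h1 := h.norm_integral_sub_boundary_le hpq fun x hx => (hmono x hx).ne'
  have hq := hmono q ⟨hpq, le_rfl⟩
  have h2 := norm_boundary_term (a := F q) (y := F₁ q)
  have h3 := norm_boundary_term (a := F p) (y := F₁ p)
  rw [abs_of_pos hq] at h2
  rw [abs_of_pos h0] at h3
  have h4 := norm_le_norm_sub_add (∫ x in p..q, osc (F x))
    (osc (F q) / (2 * Real.pi * Complex.I * F₁ q) -
        osc (F p) / (2 * Real.pi * Complex.I * F₁ p))
  have h5 := norm_sub_le (osc (F q) / (2 * Real.pi * Complex.I * F₁ q))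
    (osc (F p) / (2 * Real.pi * Complex.I * F₁ p))
  have e1 : 1 / (2 * F₁ q) = 1 / F₁ q / 2 := by field_simp
  have e2 : 1 / (2 * F₁ p) = 1 / F₁ p / 2 := by field_simp
  have e3 : 2 / F₁ p = 2 * (1 / F₁ p) := by ring
  have := one_div_pos.2 hq
  have := one_div_pos.2 h0
  rw [e3]
  linarith

lemma norm_integral_saddle_le (h : IsPhase F F₁ F₂ l) {c q : ℝ} (hc : F₁ c = 0)
    (hcq : c ≤ q) : ‖∫ x in c..q, osc (F x)‖ ≤ 3 / √l := by
  have hl := Real.sqrt_pos.2 h.pos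
  rcases le_total q (c + 1 / √l) with hq | hq
  · refine (norm_intervalIntegral_osc_le hcq).trans ?_
    have : 3 / √l = 3 * (1 / √l) := by ring
    have := one_div_pos.2 hl
    linarith
  · have h1 := h.mul_sub_le (x := c) (y := c + 1 / √l) (by linarith [one_div_pos.2 hl])
    rw [hc, sub_zero, add_sub_cancel_left, mul_one_div, Real.div_sqrt] at h1
    have h2 := h.norm_integral_le_of_pos hq (hl.trans_le h1)
    rw [← intervalIntegral.integral_add_adjacent_intervals (h.intervalIntegrable c (c + 1 / √l))
      (h.intervalIntegrable _ q)]
    have h3 := norm_intervalIntegral_osc_le (F := F) (p := c) (q := c + 1 / √l)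
      (by linarith [one_div_pos.2 hl])
    have h4 : 2 / F₁ (c + 1 / √l) ≤ 2 / √l := by gcongr
    refine (norm_add_le _ _).trans ?_
    have : 3 / √l = 1 / √l + 2 / √l := by ring
    linarith

lemma exists_saddle (h : IsPhase F F₁ F₂ l) : ∃ c, F₁ c = 0 := by
  have h1 : ∃ a, F₁ a ≤ 0 := by
    refine ⟨-(|F₁ 0| / l), ?_⟩
    have := h.mul_sub_le (x := -(|F₁ 0| / l)) (y := 0)
      (by have := div_nonneg (abs_nonneg (F₁ 0)) h.pos.le; linarith)
    rw [zero_sub, neg_neg, mul_div_cancel₀ _ h.pos.ne'] at this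
    linarith [le_abs_self (F₁ 0)]
  have h2 : ∃ a, 0 ≤ F₁ a := by
    refine ⟨|F₁ 0| / l, ?_⟩
    have := h.mul_sub_le (x := 0) (y := |F₁ 0| / l) (div_nonneg (abs_nonneg (F₁ 0)) h.pos.le)
    rw [sub_zero, mul_div_cancel₀ _ h.pos.ne'] at this
    linarith [neg_abs_le (F₁ 0)]
  obtain ⟨a, ha⟩ := h1
  obtain ⟨b, hb⟩ := h2
  exact mem_range_of_exists_le_of_exists_ge h.continuous₁ ⟨a, ha⟩ ⟨b, hb⟩

/-- Second derivative test. -/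
lemma norm_integral_le (h : IsPhase F F₁ F₂ l) (p q : ℝ) :
    ‖∫ x in p..q, osc (F x)‖ ≤ 6 / √l := by
  obtain ⟨c, hc⟩ := h.exists_saddle
  have key : ∀ r, ‖∫ x in c..r, osc (F x)‖ ≤ 3 / √l := by
    intro r
    rcases le_total c r with hr | hr
    · exact h.norm_integral_saddle_le hc hr
    · rw [intervalIntegral.integral_symm, norm_neg, ← integral_reflect]
      exact h.reflect.norm_integral_saddle_le (by simp [hc]) (by linarith)
  rw [← intervalIntegral.integral_interval_sub_left (h.intervalIntegrable c q)
    (h.intervalIntegrable c p)]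
  refine (norm_sub_le _ _).trans ?_
  have : 6 / √l = 3 / √l + 3 / √l := by ring
  linarith [key p, key q]

end IsPhase

section Fresnel

lemma norm_cexp_neg_mul_sq_le {b : ℂ} (hb : 0 < b.re) (x : ℝ) :
    ‖Complex.exp (-b * (x : ℂ) ^ 2)‖ ≤ 1 := by
  rw [Complex.norm_exp, Real.exp_le_one_iff]
  have : (-b * (x : ℂ) ^ 2).re = -b.re * x ^ 2 := by
    rw [← Complex.ofReal_pow, Complex.re_mul_ofReal, Complex.neg_re]
  rw [this]
  nlinarith [sq_nonneg x]

lemma norm_integral_Ioi_gaussian_le {b : ℂ} (hb : 0 < b.re) {Y : ℝ} (hY : 0 < Y) :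
    ‖∫ x in Set.Ioi Y, Complex.exp (-b * (x : ℂ) ^ 2)‖ ≤ 1 / (‖b‖ * Y) := by
  have hb0 : b ≠ 0 := by rintro rfl; simp at hb
  have hbn : 0 < ‖b‖ := norm_pos_iff.2 hb0
  have hi1 : IntegrableOn (fun x : ℝ => Complex.exp (-b * (x : ℂ) ^ 2)) (Set.Ioi Y) :=
    (integrable_cexp_neg_mul_sq hb).integrableOn
  have hir : IntegrableOn (fun x : ℝ => 1 / (2 * ‖b‖) * x ^ (-2 : ℝ)) (Set.Ioi Y) :=
    (integrableOn_Ioi_rpow_of_lt (by norm_num) hY).const_mul _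
  have hbound : ∀ x ∈ Set.Ioi Y,
      ‖Complex.exp (-b * (x : ℂ) ^ 2) / (2 * b * (x : ℂ) ^ 2)‖
        ≤ 1 / (2 * ‖b‖) * x ^ (-2 : ℝ) := by
    intro x hx
    have hx0 : 0 < x := hY.trans hx
    rw [Real.rpow_neg hx0.le, Real.rpow_two, norm_div]
    simp only [norm_mul, norm_pow, Complex.norm_real, Complex.norm_ofNat, Real.norm_eq_abs,
      sq_abs]
    rw [div_mul_eq_mul_div, one_mul, inv_eq_one_div, div_div, mul_comm (x ^ 2)]
    gcongr
    exact norm_cexp_neg_mul_sq_le hb x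
  have hi2 : IntegrableOn
      (fun x : ℝ => Complex.exp (-b * (x : ℂ) ^ 2) / (2 * b * (x : ℂ) ^ 2)) (Set.Ioi Y) := by
    refine Integrable.mono' hir ?_ ((ae_restrict_iff' measurableSet_Ioi).2 (ae_of_all _ hbound))
    refine Measurable.aestronglyMeasurable ?_
    fun_prop
  have hd : ∀ x ∈ Set.Ici Y,
      HasDerivAt (fun x : ℝ => -(Complex.exp (-b * (x : ℂ) ^ 2) / (2 * b * x)))
        (Complex.exp (-b * (x : ℂ) ^ 2) +
          Complex.exp (-b * (x : ℂ) ^ 2) / (2 * b * (x : ℂ) ^ 2)) x := by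
    intro x hx
    have hx0 : (x : ℂ) ≠ 0 := by exact_mod_cast (hY.trans_le hx).ne'
    have h1 : HasDerivAt (fun x : ℝ => (x : ℂ)) 1 x := Complex.ofRealCLM.hasDerivAt
    have h2 := ((h1.pow 2).const_mul (-b)).cexp.div (h1.const_mul (2 * b))
      (mul_ne_zero (mul_ne_zero two_ne_zero hb0) hx0)
    convert! h2.neg using 1
    simp only [Pi.pow_apply]
    field_simp
    push_cast
    ring
  have ht : Tendsto (fun x : ℝ => -(Complex.exp (-b * (x : ℂ) ^ 2) / (2 * b * x))) atTop
      (𝓝 0) := by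
    have h1 : Tendsto (fun x : ℝ => 1 / (2 * ‖b‖) * x⁻¹) atTop (𝓝 0) := by
      simpa using tendsto_inv_atTop_zero.const_mul (1 / (2 * ‖b‖))
    refine squeeze_zero_norm' ?_ h1
    filter_upwards [eventually_gt_atTop 0] with x hx
    rw [norm_neg, norm_div]
    simp only [norm_mul, Complex.norm_real, Complex.norm_ofNat, Real.norm_eq_abs, abs_of_pos hx]
    rw [← one_div, div_mul_div_comm, mul_one]
    gcongr
    exact norm_cexp_neg_mul_sq_le hb x
  have hmain := integral_Ioi_of_hasDerivAt_of_tendsto' hd (hi1.add hi2) ht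
  have hadd : ∫ x in Set.Ioi Y, (Complex.exp (-b * (x : ℂ) ^ 2) +
      Complex.exp (-b * (x : ℂ) ^ 2) / (2 * b * (x : ℂ) ^ 2)) =
      (∫ x in Set.Ioi Y, Complex.exp (-b * (x : ℂ) ^ 2)) +
      ∫ x in Set.Ioi Y, Complex.exp (-b * (x : ℂ) ^ 2) / (2 * b * (x : ℂ) ^ 2) :=
    integral_add hi1 hi2
  rw [hadd, zero_sub, neg_neg] at hmain
  rw [eq_sub_of_add_eq hmain]
  refine (norm_sub_le _ _).trans ?_
  have h1 : ‖Complex.exp (-b * (Y : ℂ) ^ 2) / (2 * b * Y)‖ ≤ 1 / (2 * ‖b‖) * Y⁻¹ := by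
    rw [norm_div]
    simp only [norm_mul, Complex.norm_real, Complex.norm_ofNat, Real.norm_eq_abs, abs_of_pos hY]
    rw [← one_div, div_mul_div_comm, mul_one]
    gcongr
    exact norm_cexp_neg_mul_sq_le hb Y
  have h2 : ‖∫ x in Set.Ioi Y, Complex.exp (-b * (x : ℂ) ^ 2) / (2 * b * (x : ℂ) ^ 2)‖
      ≤ 1 / (2 * ‖b‖) * Y⁻¹ := by
    refine (norm_integral_le_of_norm_le hir
      ((ae_restrict_iff' measurableSet_Ioi).2 (ae_of_all _ hbound))).trans (le_of_eq ?_)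
    rw [integral_const_mul, integral_Ioi_rpow_of_lt (by norm_num) hY]
    norm_num [Real.rpow_neg_one]
  have h3 : 1 / (‖b‖ * Y) = 1 / (2 * ‖b‖) * Y⁻¹ + 1 / (2 * ‖b‖) * Y⁻¹ := by
    field_simp; norm_num
  rw [h3]
  exact add_le_add h1 h2

lemma norm_integral_gaussian_sub_le {b : ℂ} (hb : 0 < b.re) {Y : ℝ} (hY : 0 < Y) :
    ‖(∫ x in (0 : ℝ)..Y, Complex.exp (-b * (x : ℂ) ^ 2)) - (Real.pi / b) ^ (1 / 2 : ℂ) / 2‖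
      ≤ 1 / (‖b‖ * Y) := by
  have hi := integrable_cexp_neg_mul_sq hb
  rw [← integral_gaussian_complex_Ioi hb,
    ← intervalIntegral.integral_interval_add_Ioi (hi.integrableOn (s := Set.Ioi 0))
      (hi.integrableOn (s := Set.Ioi Y)), sub_add_cancel_left, norm_neg]
  exact norm_integral_Ioi_gaussian_le hb hY

lemma I_div_cpow_half {k : ℝ} (hk : 0 < k) :
    (Complex.I / k) ^ (1 / 2 : ℂ) = Complex.exp (Real.pi * Complex.I / 4) / (√k : ℂ) := by
  have hI : Complex.I / k = ((1 / k : ℝ) : ℂ) * Complex.I := by push_cast; ring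
  have hs : √k = Real.exp (Real.log k / 2) := by rw [Real.exp_half, Real.exp_log hk]
  have hk' : 0 < 1 / k := one_div_pos.2 hk
  rw [hI, Complex.cpow_def_of_ne_zero
      (mul_ne_zero (by exact_mod_cast hk'.ne') Complex.I_ne_zero),
    Complex.log_ofReal_mul hk' Complex.I_ne_zero, Complex.log_I, hs, one_div, Real.log_inv,
    Complex.ofReal_exp, ← Complex.exp_sub]
  congr 1
  push_cast
  ring

/-- Truncated Fresnel integral. -/
lemma norm_fresnel_sub_le {k Y : ℝ} (hk : 0 < k) (hY : 0 < Y) :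
    ‖(∫ u in (0 : ℝ)..Y, osc (k * u ^ 2 / 2)) -
      Complex.exp (Real.pi * Complex.I / 4) / (2 * (√k : ℂ))‖ ≤ 1 / (k * Y) := by
  set b : ℝ → ℂ := fun ε => (ε : ℂ) - Real.pi * Complex.I * k with hbdef
  have hbc : Continuous b := by fun_prop
  have hb0 : b 0 = -(Real.pi * Complex.I * k) := by simp [hbdef]
  have hkC : (k : ℂ) ≠ 0 := by exact_mod_cast hk.ne'
  have hpi : (Real.pi : ℂ) ≠ 0 := by exact_mod_cast Real.pi_ne_zero
  have hb0' : b 0 ≠ 0 := by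
    rw [hb0]; exact neg_ne_zero.2 (mul_ne_zero (mul_ne_zero hpi Complex.I_ne_zero) hkC)
  have hdiv : (Real.pi : ℂ) / b 0 = Complex.I / k := by
    have hne : (Real.pi * Complex.I * k : ℂ) ≠ 0 :=
      mul_ne_zero (mul_ne_zero hpi Complex.I_ne_zero) hkC
    rw [hb0, div_eq_div_iff (neg_ne_zero.2 hne) hkC]
    linear_combination (Real.pi * k : ℂ) * Complex.I_mul_I
  have hl : Tendsto (fun ε => ‖(∫ x in (0 : ℝ)..Y, Complex.exp (-b ε * (x : ℂ) ^ 2)) -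
      (Real.pi / b ε) ^ (1 / 2 : ℂ) / 2‖) (𝓝[>] 0)
      (𝓝 ‖(∫ x in (0 : ℝ)..Y, Complex.exp (-b 0 * (x : ℂ) ^ 2)) -
      (Real.pi / b 0) ^ (1 / 2 : ℂ) / 2‖) := by
    refine Tendsto.norm (Tendsto.sub ?_ (Tendsto.div_const ?_ 2))
    · refine Continuous.tendsto' ?_ 0 _ rfl |>.mono_left nhdsWithin_le_nhds
      refine intervalIntegral.continuous_parametric_intervalIntegral_of_continuous' ?_ _ _
      fun_prop
    · have h1 : ContinuousAt (fun ε => (Real.pi : ℂ) / b ε) 0 :=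
        continuousAt_const.div hbc.continuousAt hb0'
      refine (h1.cpow continuousAt_const ?_).tendsto.mono_left nhdsWithin_le_nhds
      rw [hdiv]
      right
      simp [Complex.div_im, hk.ne']
  have hle : ‖(∫ x in (0 : ℝ)..Y, Complex.exp (-b 0 * (x : ℂ) ^ 2)) -
      (Real.pi / b 0) ^ (1 / 2 : ℂ) / 2‖ ≤ 1 / (k * Y) := by
    refine le_of_tendsto hl ?_
    filter_upwards [self_mem_nhdsWithin] with ε hε
    have hε' : 0 < ε := hε
    have hre : 0 < (b ε).re := by simpa [hbdef] using hε'
    refine (norm_integral_gaussian_sub_le hre hY).trans ?_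
    have him : (b ε).im = -(Real.pi * k) := by simp [hbdef]
    have : k ≤ ‖b ε‖ := by
      refine le_trans ?_ (Complex.abs_im_le_norm (b ε))
      rw [him, abs_neg, abs_of_pos (by positivity)]
      nlinarith [Real.pi_gt_three]
    gcongr
  rw [hdiv, I_div_cpow_half hk] at hle
  convert hle using 3
  · refine intervalIntegral.integral_congr fun x _ => ?_
    simp only [osc, hb0]
    congr 1
    push_cast
    ring
  · rw [div_div, mul_comm (2 : ℂ)]

end Fresnel

namespace IsPhase

variable {F F₁ F₂ : ℝ → ℝ} {l : ℝ}

lemma abs_sub_quadratic_le (h : IsPhase F F₁ F₂ l) {K : ℝ} (hK0 : 0 ≤ K)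
    (hK : ∀ x y, |F₂ x - F₂ y| ≤ K * |x - y|) {c : ℝ} (hc : F₁ c = 0) {x : ℝ} (hx : c ≤ x) :
    |F x - (F c + F₂ c * (x - c) ^ 2 / 2)| ≤ K * (x - c) ^ 3 := by
  have h1 : ∀ y ∈ Set.Icc c x, |F₁ y - F₂ c * (y - c)| ≤ K * (x - c) ^ 2 := by
    intro y hy
    have := Convex.norm_image_sub_le_of_norm_hasDerivWithin_le
      (f := fun y => F₁ y - F₂ c * (y - c)) (f' := fun y => F₂ y - F₂ c) (s := Set.Icc c x)
      (x := c) (y := y) (C := K * (x - c))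
      (fun z _ => by
        have := (h.deriv₁ z).sub (((hasDerivAt_id z).sub_const c).const_mul (F₂ c))
        convert! this.hasDerivWithinAt using 1
        ring)
      (fun z hz => by
        refine (hK z c).trans ?_
        rw [abs_of_nonneg (by linarith [hz.1])]
        gcongr
        exact hz.2)
      (convex_Icc c x) ⟨le_rfl, hx⟩ hy
    rw [hc, sub_self, mul_zero, sub_zero, sub_zero, Real.norm_eq_abs, Real.norm_eq_abs,
      abs_of_nonneg (sub_nonneg.2 hy.1)] at this
    refine this.trans ?_
    rw [sq, ← mul_assoc]
    have h0 : 0 ≤ K * (x - c) := mul_nonneg hK0 (by linarith)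
    exact mul_le_mul_of_nonneg_left (by linarith [hy.2]) h0
  have := Convex.norm_image_sub_le_of_norm_hasDerivWithin_le
    (f := fun y => F y - (F c + F₂ c * (y - c) ^ 2 / 2)) (f' := fun y => F₁ y - F₂ c * (y - c))
    (s := Set.Icc c x) (x := c) (y := x) (C := K * (x - c) ^ 2)
    (fun z _ => by
      have := (h.deriv z).sub
        ((((((hasDerivAt_id z).sub_const c).pow 2).const_mul (F₂ c)).div_const 2).const_add (F c))
      convert! this.hasDerivWithinAt using 1
      simp
      ring)
    h1 (convex_Icc c x) ⟨le_rfl, hx⟩ ⟨hx, le_rfl⟩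
  simp only [Real.norm_eq_abs] at this
  rw [abs_of_nonneg (sub_nonneg.2 hx)] at this
  refine le_trans (le_of_eq ?_) (this.trans (le_of_eq ?_))
  · congr 1; ring
  · ring

/-- Half of the stationary phase contribution of a saddle point `c`. -/
lemma norm_half_saddle_le (h : IsPhase F F₁ F₂ l) (c : ℝ) :
    ‖osc (F c) * (Complex.exp (Real.pi * Complex.I / 4) / (2 * (√(F₂ c) : ℂ)))‖ ≤ 1 / √l := by
  have h2 : ‖Complex.exp (Real.pi * Complex.I / 4)‖ = 1 := by
    have : (Real.pi * Complex.I / 4 : ℂ) = ((Real.pi / 4 : ℝ) : ℂ) * Complex.I := by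
      push_cast; ring
    rw [this, Complex.norm_exp_ofReal_mul_I]
  rw [norm_mul, norm_osc, one_mul, norm_div, h2, norm_mul, Complex.norm_real,
    Complex.norm_ofNat, Real.norm_eq_abs, abs_of_nonneg (Real.sqrt_nonneg _)]
  have h3 : √l ≤ √(F₂ c) := Real.sqrt_le_sqrt (h.le c)
  have h4 := Real.sqrt_pos.2 h.pos
  gcongr
  linarith

lemma norm_stationary_phase_le_const (h : IsPhase F F₁ F₂ l) {c t : ℝ} (hc : F₁ c = 0)
    (hct : c ≤ t) :
    ‖(∫ x in c..t, osc (F x)) -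
      osc (F c) * (Complex.exp (Real.pi * Complex.I / 4) / (2 * (√(F₂ c) : ℂ)))‖ ≤ 4 / √l := by
  refine (norm_sub_le _ _).trans ?_
  have : 4 / √l = 3 / √l + 1 / √l := by ring
  linarith [h.norm_integral_saddle_le hc hct, h.norm_half_saddle_le c]

/-- One-sided stationary phase. -/
lemma norm_stationary_phase_le (h : IsPhase F F₁ F₂ l) {B K : ℝ} (hB : ∀ x, F₂ x ≤ B * l)
    (hK0 : 0 ≤ K) (hK : ∀ x y, |F₂ x - F₂ y| ≤ K * |x - y|) {c t δ : ℝ} (hc : F₁ c = 0)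
    (hct : c < t) (hδ : 0 < δ) :
    ‖(∫ x in c..t, osc (F x)) -
      osc (F c) * (Complex.exp (Real.pi * Complex.I / 4) / (2 * (√(F₂ c) : ℂ)))‖ ≤
      3 / (l * δ) + 7 * K * δ ^ 4 + B / F₁ t := by
  have hl := h.pos
  have hB0 : 0 < B := by
    have := hl.trans_le ((h.le 0).trans (hB 0))
    exact (pos_iff_pos_of_mul_pos this).2 hl
  have hFt : 0 < F₁ t := by
    have := h.mul_sub_le hct.le
    have h1 : 0 < l * (t - c) := mul_pos hl (sub_pos.2 hct)
    linarith
  set T := min t (c + δ) with hT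
  have hcT : c < T := lt_min hct (by linarith)
  have hTt : T ≤ t := min_le_left _ _
  have hTδ : T - c ≤ δ := by linarith [min_le_right t (c + δ)]
  have hY : 0 < T - c := sub_pos.2 hcT
  have h1 : ‖∫ x in T..t, osc (F x)‖ ≤ 2 / (l * δ) := by
    rcases le_total t (c + δ) with ht | ht
    · rw [hT, min_eq_left ht, intervalIntegral.integral_same, norm_zero]; positivity
    · rw [hT, min_eq_right ht]
      have h2 := h.mul_sub_le (x := c) (y := c + δ) (by linarith)
      rw [hc, sub_zero, add_sub_cancel_left] at h2
      have hlδ : 0 < l * δ := mul_pos hl hδ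
      refine (h.norm_integral_le_of_pos ht (hlδ.trans_le h2)).trans ?_
      gcongr
  have h2 : ‖(∫ x in c..T, osc (F x)) -
      osc (F c) * ∫ u in (0 : ℝ)..(T - c), osc (F₂ c * u ^ 2 / 2)‖ ≤ 7 * K * δ ^ 4 := by
    have e1 : osc (F c) * (∫ u in (0 : ℝ)..(T - c), osc (F₂ c * u ^ 2 / 2)) =
        ∫ x in c..T, osc (F c + F₂ c * (x - c) ^ 2 / 2) := by
      have := intervalIntegral.integral_comp_sub_right (a := c) (b := T)
        (fun u => osc (F c) * osc (F₂ c * u ^ 2 / 2)) c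
      rw [sub_self] at this
      rw [← intervalIntegral.integral_const_mul, ← this]
      simp only [osc_add]
    rw [e1, ← intervalIntegral.integral_sub (h.intervalIntegrable _ _)
      (Continuous.intervalIntegrable (by fun_prop) _ _)]
    refine (intervalIntegral.norm_integral_le_of_norm_le_const (C := 7 * K * δ ^ 3)
      fun x hx => ?_).trans ?_
    · rw [Set.uIoc_of_le hcT.le] at hx
      refine (norm_osc_sub_osc_le _ _).trans ?_
      have h3 := h.abs_sub_quadratic_le hK0 hK hc hx.1.le
      have h4 : (x - c) ^ 3 ≤ δ ^ 3 :=
        pow_le_pow_left₀ (by linarith [hx.1]) (by linarith [hx.2]) 3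
      have h5 : 2 * Real.pi ≤ 7 := by linarith [Real.pi_lt_d2]
      calc _ ≤ 7 * (K * δ ^ 3) :=
            mul_le_mul h5 (h3.trans (by gcongr)) (abs_nonneg _) (by norm_num)
        _ = _ := by ring
    · rw [abs_of_pos hY]
      calc _ ≤ 7 * K * δ ^ 3 * δ := by gcongr
        _ = _ := by ring
  have h3 : ‖osc (F c) * (∫ u in (0 : ℝ)..(T - c), osc (F₂ c * u ^ 2 / 2)) -
      osc (F c) * (Complex.exp (Real.pi * Complex.I / 4) / (2 * (√(F₂ c) : ℂ)))‖ ≤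
      1 / (l * δ) + B / F₁ t := by
    rw [← mul_sub, norm_mul, norm_osc, one_mul]
    refine (norm_fresnel_sub_le (hl.trans_le (h.le c)) hY).trans ?_
    have h4 : 1 / (F₂ c * (T - c)) ≤ 1 / (l * (T - c)) := by
      have := h.le c
      gcongr
    refine h4.trans ?_
    rcases le_total t (c + δ) with ht | ht
    · rw [hT, min_eq_left ht]
      have h5 : F₁ t ≤ B * l * (t - c) := by
        have hd : Differentiable ℝ F₁ := fun x => (h.deriv₁ x).differentiableAt
        have := image_sub_le_mul_sub_of_deriv_le hd
          (C := B * l) (fun z => by rw [(h.deriv₁ z).deriv]; exact hB z) hct.le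
        linarith
      have h6 : 1 / (l * (t - c)) ≤ B / F₁ t := by
        have : 0 < t - c := by linarith
        rw [div_le_div_iff₀ (by positivity) hFt]
        nlinarith
      have : 0 < 1 / (l * δ) := by positivity
      linarith
    · rw [hT, min_eq_right ht, add_sub_cancel_left]
      have : 0 < B / F₁ t := by positivity
      linarith
  rw [← intervalIntegral.integral_add_adjacent_intervals (h.intervalIntegrable c T)
    (h.intervalIntegrable T t)]
  have e : 3 / (l * δ) = 2 / (l * δ) + 1 / (l * δ) := by ring
  rw [e]
  calc _ = ‖((∫ x in c..T, osc (F x)) -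
      osc (F c) * ∫ u in (0 : ℝ)..(T - c), osc (F₂ c * u ^ 2 / 2)) +
      (osc (F c) * (∫ u in (0 : ℝ)..(T - c), osc (F₂ c * u ^ 2 / 2)) -
      osc (F c) * (Complex.exp (Real.pi * Complex.I / 4) / (2 * (√(F₂ c) : ℂ)))) +
      ∫ x in T..t, osc (F x)‖ := by congr 1; ring
    _ ≤ _ := norm_add₃_le
    _ ≤ _ := by linarith

end IsPhase

section Sums

lemma summable_and_norm_tsum_sub_le {h : ℤ → ℂ} {p q : ℤ} (hpq : p ≤ q + 1) {b : ℕ → ℝ} {B : ℝ}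
    (hr : ∀ j : ℕ, ‖h (q + 1 + j)‖ ≤ b j) (hl : ∀ j : ℕ, ‖h (p - 1 - j)‖ ≤ b j)
    (hB : ∀ n, ∑ j ∈ Finset.range n, b j ≤ B) :
    Summable h ∧ ‖(∑' k, h k) - ∑ k ∈ Finset.Icc p q, h k‖ ≤ 2 * B := by
  have hsucc : ∀ n : ℕ, Finset.Icc (p - (n + 1 : ℕ)) (q + (n + 1 : ℕ)) =
      insert (p - 1 - n : ℤ) (insert (q + 1 + n : ℤ) (Finset.Icc (p - n) (q + n))) := by
    intro n; ext k; simp only [Finset.mem_insert, Finset.mem_Icc]; push_cast; omega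
  have hn1 : ∀ n : ℕ, (q + 1 + n : ℤ) ∉ Finset.Icc (p - n) (q + n) := by
    intro n; simp only [Finset.mem_Icc]; omega
  have hn2 : ∀ n : ℕ, (p - 1 - n : ℤ) ∉ insert (q + 1 + n : ℤ) (Finset.Icc (p - n) (q + n)) := by
    intro n; simp only [Finset.mem_insert, Finset.mem_Icc]; omega
  have hnorm : ∀ n : ℕ, ∑ k ∈ Finset.Icc (p - n) (q + n), ‖h k‖ ≤
      ∑ k ∈ Finset.Icc p q, ‖h k‖ + 2 * ∑ j ∈ Finset.range n, b j := by
    intro n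
    induction n with
    | zero => simp
    | succ n ih =>
      rw [hsucc, Finset.sum_insert (hn2 n), Finset.sum_insert (hn1 n), Finset.sum_range_succ]
      linarith [hr n, hl n]
  have hdiff : ∀ n : ℕ, ‖∑ k ∈ Finset.Icc (p - n) (q + n), h k - ∑ k ∈ Finset.Icc p q, h k‖ ≤
      2 * ∑ j ∈ Finset.range n, b j := by
    intro n
    induction n with
    | zero => simp
    | succ n ih =>
      rw [hsucc, Finset.sum_insert (hn2 n), Finset.sum_insert (hn1 n), Finset.sum_range_succ,
        add_sub_assoc, add_sub_assoc]
      refine (norm_add_le _ _).trans ?_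
      have := norm_add_le (h (q + 1 + n))
        (∑ k ∈ Finset.Icc (p - n) (q + n), h k - ∑ k ∈ Finset.Icc p q, h k)
      linarith [hr n, hl n]
  have hsub : ∀ u : Finset ℤ, ∃ n₀ : ℕ, ∀ n : ℕ, n₀ ≤ n → u ⊆ Finset.Icc (p - n) (q + n) := by
    intro u
    refine ⟨∑ k ∈ u, (k.natAbs + p.natAbs + q.natAbs), fun n hn k hk => ?_⟩
    have h1 := Finset.single_le_sum (f := fun k : ℤ => k.natAbs + p.natAbs + q.natAbs)
      (fun _ _ => Nat.zero_le _) hk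
    rw [Finset.mem_Icc]
    omega
  have hs : Summable h := by
    refine Summable.of_norm (summable_of_sum_le (c := ∑ k ∈ Finset.Icc p q, ‖h k‖ + 2 * B)
      (fun _ => norm_nonneg _) fun u => ?_)
    obtain ⟨n, hn⟩ := hsub u
    refine (Finset.sum_le_sum_of_subset_of_nonneg (hn n le_rfl)
      fun _ _ _ => norm_nonneg _).trans ((hnorm n).trans ?_)
    linarith [hB n]
  refine ⟨hs, ?_⟩
  have ht : Tendsto (fun n : ℕ => Finset.Icc (p - n) (q + n)) atTop atTop :=
    tendsto_atTop.2 fun u => by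
      obtain ⟨n, hn⟩ := hsub u
      filter_upwards [eventually_ge_atTop n] with m hm using hn m hm
  refine le_of_tendsto ((((hs.hasSum : Tendsto _ _ _).comp ht).sub_const _).norm)
    (Eventually.of_forall fun n => ?_)
  exact (hdiff n).trans (by linarith [hB n])

lemma sum_one_div_sub_le {D : ℝ} (hD : 0 ≤ D) (n : ℕ) :
    ∑ j ∈ Finset.range n, (1 / ((j : ℝ) + 1) - 1 / ((j : ℝ) + 1 + D)) ≤ 1 + Real.log (1 + D) := by
  have key : ∀ n : ℕ, ∑ j ∈ Finset.range (n + 1), (1 / ((j : ℝ) + 1) - 1 / ((j : ℝ) + 1 + D)) ≤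
      1 + Real.log (1 + D) - Real.log (1 + D / (n + 1)) := by
    intro n
    induction n with
    | zero =>
      have : 0 ≤ 1 / (1 + D) := by positivity
      simp
      linarith
    | succ n ih =>
      rw [Finset.sum_range_succ]
      push_cast
      have hn : (0 : ℝ) ≤ n := n.cast_nonneg
      have h1 : 0 < 1 + D / ((n : ℝ) + 1) := by positivity
      have h2 : 0 < 1 + D / ((n : ℝ) + 1 + 1) := by positivity
      have h3 := Real.one_sub_inv_le_log_of_pos (div_pos h1 h2)
      rw [Real.log_div h1.ne' h2.ne'] at h3
      have h4 : 1 / ((n : ℝ) + 1 + 1) - 1 / ((n : ℝ) + 1 + 1 + D) ≤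
          1 - ((1 + D / ((n : ℝ) + 1)) / (1 + D / ((n : ℝ) + 1 + 1)))⁻¹ := by
        have e1 : 1 / ((n : ℝ) + 1 + 1) - 1 / ((n : ℝ) + 1 + 1 + D) =
            D / (((n : ℝ) + 1 + 1) * ((n : ℝ) + 1 + 1 + D)) := by
          field_simp; ring
        have e2 : 1 - ((1 + D / ((n : ℝ) + 1)) / (1 + D / ((n : ℝ) + 1 + 1)))⁻¹ =
            D / (((n : ℝ) + 1 + 1) * ((n : ℝ) + 1 + D)) := by
          field_simp; ring
        rw [e1, e2]
        gcongr
        linarith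
      linarith
  rcases n with _ | n
  · simp; linarith [Real.log_nonneg (show (1 : ℝ) ≤ 1 + D by linarith)]
  · have : 0 ≤ Real.log (1 + D / (n + 1)) := Real.log_nonneg (by
      have : 0 ≤ D / ((n : ℝ) + 1) := by positivity
      linarith)
    linarith [key n]

lemma sum_one_div_sq_le (n : ℕ) :
    ∑ j ∈ Finset.range n, 1 / ((j : ℝ) + 1) ^ 2 ≤ 2 := by
  have key : ∀ n : ℕ, ∑ j ∈ Finset.range (n + 1), 1 / ((j : ℝ) + 1) ^ 2 ≤ 2 - 1 / ((n : ℝ) + 1) := by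
    intro n
    induction n with
    | zero => norm_num
    | succ n ih =>
      rw [Finset.sum_range_succ]
      push_cast
      have hn : (0 : ℝ) ≤ n := n.cast_nonneg
      have e : 1 / ((n : ℝ) + 1 + 1) ^ 2 ≤ 1 / ((n : ℝ) + 1) - 1 / ((n : ℝ) + 1 + 1) := by
        have : 1 / ((n : ℝ) + 1) - 1 / ((n : ℝ) + 1 + 1) =
          1 / (((n : ℝ) + 1) * ((n : ℝ) + 1 + 1)) := by field_simp; ring
        rw [this, sq]
        gcongr
        linarith
      linarith
  rcases n with _ | n
  · simp
  · have : 0 ≤ 1 / ((n : ℝ) + 1) := by positivity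
    linarith [key n]

lemma sum_Icc_le_right {h : ℤ → ℝ} {p q : ℤ} {M a c D : ℝ} (hM : 0 ≤ M) (ha : 0 ≤ a)
    (hc : 0 ≤ c) (hD : 0 ≤ D) (hqp : (q : ℝ) - p ≤ D) (h0 : p ≤ q → h q ≤ M)
    (h1 : ∀ j : ℤ, 1 ≤ j → p ≤ q - j → h (q - j) ≤ a + c / j) :
    ∑ k ∈ Finset.Icc p q, h k ≤ M + D * a + c * (1 + Real.log (1 + D)) := by
  have hlog : 0 ≤ Real.log (1 + D) := Real.log_nonneg (by linarith)
  rcases lt_or_ge q p with hlt | hle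
  · rw [Finset.Icc_eq_empty (not_le.2 hlt), Finset.sum_empty]; positivity
  obtain ⟨n, rfl⟩ : ∃ n : ℕ, p = q - n := ⟨(q - p).toNat, by omega⟩
  have hnD : (n : ℝ) ≤ D := by push_cast at hqp; linarith
  have e : ∑ k ∈ Finset.Icc (q - n : ℤ) q, h k = ∑ j ∈ Finset.range (n + 1), h (q - j) := by
    symm
    refine Finset.sum_nbij (fun j : ℕ => q - (j : ℤ)) ?_ ?_ ?_ ?_
    · intro j hj; simp only [Finset.mem_range, Finset.mem_Icc] at *; omega
    · intro i _ j _ hij; simpa using hij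
    · intro k hk
      simp only [Finset.coe_Icc, Set.mem_Icc] at hk
      refine ⟨(q - k).toNat, ?_, ?_⟩
      · simp only [Finset.coe_range, Set.mem_Iio]; omega
      · simp only; omega
    · intro j _; rfl
  rw [e, Finset.sum_range_succ']
  have hsum : ∑ j ∈ Finset.range n, h (q - ((j + 1 : ℕ) : ℤ)) ≤
      n * a + c * (1 + Real.log (1 + D)) := by
    calc _ ≤ ∑ j ∈ Finset.range n, (a + c * ((j : ℝ) + 1)⁻¹) := by
          refine Finset.sum_le_sum fun j hj => ?_
          rw [Finset.mem_range] at hj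
          refine (h1 _ (by omega) (by omega)).trans (le_of_eq ?_)
          push_cast; ring
      _ = n * a + c * (harmonic n : ℝ) := by
          rw [Finset.sum_add_distrib, ← Finset.mul_sum, harmonic]
          simp
      _ ≤ _ := by
          have h2 := harmonic_le_one_add_log n
          have h3 : Real.log n ≤ Real.log (1 + D) := by
            rcases Nat.eq_zero_or_pos n with rfl | hn
            · simpa using hlog
            · exact Real.log_le_log (by exact_mod_cast hn) (by linarith)
          gcongr
          linarith
  have h2 : (n : ℝ) * a ≤ D * a := by gcongr
  have h3 := h0 hle
  simp only [Nat.cast_zero, sub_zero]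
  linarith

lemma sum_Icc_le_left {h : ℤ → ℝ} {p q : ℤ} {M a c D : ℝ} (hM : 0 ≤ M) (ha : 0 ≤ a)
    (hc : 0 ≤ c) (hD : 0 ≤ D) (hqp : (q : ℝ) - p ≤ D) (h0 : p ≤ q → h p ≤ M)
    (h1 : ∀ j : ℤ, 1 ≤ j → p + j ≤ q → h (p + j) ≤ a + c / j) :
    ∑ k ∈ Finset.Icc p q, h k ≤ M + D * a + c * (1 + Real.log (1 + D)) := by
  have e : ∑ k ∈ Finset.Icc p q, h k = ∑ k ∈ Finset.Icc (-q) (-p), h (-k) := by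
    refine Finset.sum_equiv (Equiv.neg ℤ) (fun k => ?_) fun k _ => by simp
    simp only [Finset.mem_Icc, Equiv.neg_apply]; omega
  rw [e]
  refine sum_Icc_le_right hM ha hc hD (by push_cast; linarith) (fun hp => ?_) fun j hj hp => ?_
  · simpa using h0 (by omega)
  · have := h1 j hj (by omega)
    rwa [show -(-p - j) = p + j by ring]

end Sums

section Tail

/-- Fourier transform of the one-sided tent function on `[0, 1]`. -/
noncomputable def tentTransform (y : ℝ) : ℂ := ∫ u in (0 : ℝ)..1, ((1 - u : ℝ) : ℂ) * osc (y * u)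

lemma norm_tentTransform_le_one (y : ℝ) : ‖tentTransform y‖ ≤ 1 := by
  refine (intervalIntegral.norm_integral_le_of_norm_le_const (C := 1) fun x hx => ?_).trans ?_
  · rw [Set.uIoc_of_le zero_le_one] at hx
    rw [norm_mul, norm_osc, mul_one, Complex.norm_real, Real.norm_eq_abs, abs_le]
    constructor <;> linarith [hx.1, hx.2]
  · norm_num

lemma norm_tentTransform_add_le {y : ℝ} (hy : y ≠ 0) :
    ‖tentTransform y + 1 / (2 * Real.pi * Complex.I * y)‖ ≤ 1 / y ^ 2 := by
  set w : ℂ := 2 * Real.pi * Complex.I * y with hw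
  have hw0 : w ≠ 0 := mul_ne_zero Complex.two_pi_I_ne_zero (by exact_mod_cast hy)
  have hd : ∀ x ∈ Set.uIcc (0 : ℝ) 1,
      HasDerivAt (fun u : ℝ => ((1 - u : ℝ) : ℂ) * osc (y * u) / w + osc (y * u) / w ^ 2)
        (((1 - x : ℝ) : ℂ) * osc (y * x)) x := by
    intro x _
    have h1 : HasDerivAt (fun u : ℝ => osc (y * u)) (w * osc (y * x)) x := by
      have := HasDerivAt.osc ((hasDerivAt_id x).const_mul y)
      simpa [hw] using this
    have h2 : HasDerivAt (fun u : ℝ => ((1 - u : ℝ) : ℂ)) (-1) x := by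
      simpa using ((hasDerivAt_id x).const_sub 1).ofReal_comp
    convert! ((h2.mul h1).div_const w).add (h1.div_const (w ^ 2)) using 1
    field_simp
    ring
  have hint := intervalIntegral.integral_eq_sub_of_hasDerivAt hd
    (Continuous.intervalIntegrable (by fun_prop) _ _)
  have e : tentTransform y + 1 / w = (osc y - 1) / w ^ 2 := by
    rw [tentTransform, hint]
    simp
    ring
  have hwn : ‖w‖ = 2 * Real.pi * |y| := by
    rw [hw]
    simp only [norm_mul, Complex.norm_I, Complex.norm_real, Real.norm_eq_abs,
      abs_of_pos Real.pi_pos, Complex.norm_ofNat, mul_one]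
  rw [e, norm_div, norm_pow, hwn, mul_pow, sq_abs]
  have h1 : ‖osc y - 1‖ ≤ 2 := by
    refine (norm_sub_le _ _).trans ?_
    rw [norm_osc, norm_one]; norm_num
  have h2 : 0 < y ^ 2 := by positivity
  rw [div_le_div_iff₀ (by positivity) h2]
  have h3 : (2 : ℝ) ≤ (2 * Real.pi) ^ 2 := by nlinarith [Real.pi_gt_three]
  nlinarith

lemma norm_tentTransform_le {y : ℝ} (hy : y ≠ 0) : ‖tentTransform y‖ ≤ 2 / |y| := by
  have hy0 : 0 < |y| := abs_pos.2 hy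
  rcases le_total |y| 1 with h | h
  · refine (norm_tentTransform_le_one y).trans ?_
    rw [le_div_iff₀ hy0]; linarith
  · have h1 := norm_tentTransform_add_le hy
    have h2 := IsPhase.norm_boundary_term (a := 0) (y := y)
    rw [osc_zero] at h2
    have h3 := norm_sub_le (tentTransform y + 1 / (2 * Real.pi * Complex.I * y))
      (1 / (2 * Real.pi * Complex.I * y))
    rw [add_sub_cancel_right] at h3
    have h4 : 1 / y ^ 2 ≤ 1 / |y| := by
      rw [← sq_abs]
      gcongr
      nlinarith
    have h5 : 1 / (2 * |y|) ≤ 1 / |y| := by gcongr; linarith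
    have h6 : 2 / |y| = 1 / |y| + 1 / |y| := by ring
    linarith

end Tail

section Poisson

open scoped FourierTransform

/-- The function `e(f)` on `[s, t]`, continued by damped linear phases on `[s - 1, s]` and
`[t, t + 1]`, and by zero elsewhere. -/
noncomputable def smoothed (f f₁ : ℝ → ℝ) (s t x : ℝ) : ℂ :=
  ((max 0 (min 1 (min (x - s + 1) (t + 1 - x))) : ℝ) : ℂ) *
    osc (f (max s (min t x)) + f₁ (max s (min t x)) * (x - max s (min t x)))

variable {f f₁ f₂ : ℝ → ℝ} {l s t : ℝ}

lemma continuous_smoothed (h : IsPhase f f₁ f₂ l) : Continuous (smoothed f f₁ s t) := by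
  have h1 := h.continuous
  have h2 := h.continuous₁
  unfold smoothed
  fun_prop

lemma smoothed_of_mem {x : ℝ} (hx : x ∈ Set.Icc s t) : smoothed f f₁ s t x = osc (f x) := by
  obtain ⟨h1, h2⟩ := hx
  rw [smoothed, min_eq_right h2, max_eq_right h1,
    min_eq_left (le_min (by linarith) (by linarith)), max_eq_right zero_le_one]
  simp

lemma smoothed_of_right (hst : s ≤ t) {x : ℝ} (hx : x ∈ Set.Icc t (t + 1)) :
    smoothed f f₁ s t x = ((t + 1 - x : ℝ) : ℂ) * osc (f t + f₁ t * (x - t)) := by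
  obtain ⟨h1, h2⟩ := hx
  rw [smoothed, min_eq_left h1, max_eq_right hst, min_eq_right (a := x - s + 1) (by linarith),
    min_eq_right (by linarith), max_eq_right (by linarith)]

lemma smoothed_of_left (hst : s ≤ t) {x : ℝ} (hx : x ∈ Set.Icc (s - 1) s) :
    smoothed f f₁ s t x = ((x - s + 1 : ℝ) : ℂ) * osc (f s + f₁ s * (x - s)) := by
  obtain ⟨h1, h2⟩ := hx
  rw [smoothed, min_eq_right (a := t) (by linarith), max_eq_left h2,
    min_eq_left (a := x - s + 1) (by linarith), min_eq_right (by linarith),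
    max_eq_right (by linarith)]

lemma smoothed_eq_zero {x : ℝ} (hx : x ∉ Set.Ioo (s - 1) (t + 1)) : smoothed f f₁ s t x = 0 := by
  have : min 1 (min (x - s + 1) (t + 1 - x)) ≤ 0 := by
    refine (min_le_right _ _).trans ?_
    by_contra hc
    rw [not_le, lt_min_iff] at hc
    exact hx ⟨by linarith, by linarith⟩
  rw [smoothed, max_eq_left this]
  simp

lemma norm_smoothed_le (x : ℝ) : ‖smoothed f f₁ s t x‖ ≤ 1 := by
  rw [smoothed, norm_mul, norm_osc, mul_one, Complex.norm_real, Real.norm_eq_abs,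
    abs_of_nonneg (le_max_left _ _)]
  exact max_le zero_le_one (min_le_left _ _)

lemma fourier_smoothed (h : IsPhase f f₁ f₂ l) (hst : s ≤ t) (y : ℝ) :
    𝓕 (smoothed f f₁ s t) y = osc (f s - y * s) * tentTransform (y - f₁ s) +
      (∫ x in s..t, osc (f x - y * x)) + osc (f t - y * t) * tentTransform (f₁ t - y) := by
  have hcont := continuous_smoothed (s := s) (t := t) h
  set g : ℝ → ℂ := fun x => osc (-(y * x)) * smoothed f f₁ s t x with hg
  have hgc : Continuous g := by fun_prop
  have hgi : ∀ a b, IntervalIntegrable g volume a b := fun a b => hgc.intervalIntegrable a b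
  have h1 : 𝓕 (smoothed f f₁ s t) y = ∫ x in (s - 1)..(t + 1), g x := by
    rw [Real.fourier_real_eq_integral_exp_smul, intervalIntegral.integral_eq_integral_of_support_subset]
    · refine integral_congr_ae (ae_of_all _ fun x => ?_)
      simp only [hg, smul_eq_mul, osc]
      congr 2
      push_cast
      ring
    · intro x hx
      by_contra hc
      refine hx ?_
      simp only [hg]
      rw [smoothed_eq_zero fun hx' => hc ⟨hx'.1, hx'.2.le⟩, mul_zero]
  have h2 : ∫ x in s..t, g x = ∫ x in s..t, osc (f x - y * x) := by
    refine intervalIntegral.integral_congr fun x hx => ?_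
    rw [Set.uIcc_of_le hst] at hx
    simp only [hg]
    rw [smoothed_of_mem hx, ← osc_add]
    congr 1; ring
  have h3 : ∫ x in t..(t + 1), g x = osc (f t - y * t) * tentTransform (f₁ t - y) := by
    have e := intervalIntegral.integral_comp_add_right (a := 0) (b := 1) g t
    rw [zero_add, add_comm 1 t] at e
    rw [← e, tentTransform, ← intervalIntegral.integral_const_mul]
    refine intervalIntegral.integral_congr fun u hu => ?_
    rw [Set.uIcc_of_le zero_le_one] at hu
    simp only [hg]
    rw [smoothed_of_right hst ⟨by linarith [hu.1], by linarith [hu.2]⟩,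
      mul_left_comm, ← osc_add, mul_left_comm, ← osc_add]
    congr 2 <;> ring
  have h4 : ∫ x in (s - 1)..s, g x = osc (f s - y * s) * tentTransform (y - f₁ s) := by
    have e := intervalIntegral.integral_comp_sub_left (a := 0) (b := 1) g s
    rw [sub_zero] at e
    rw [← e, tentTransform, ← intervalIntegral.integral_const_mul]
    refine intervalIntegral.integral_congr fun u hu => ?_
    rw [Set.uIcc_of_le zero_le_one] at hu
    simp only [hg]
    rw [smoothed_of_left hst ⟨by linarith [hu.2], by linarith [hu.1]⟩,
      mul_left_comm, ← osc_add, mul_left_comm, ← osc_add]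
    congr 2 <;> ring
  rw [h1, ← h2, ← h3, ← h4, intervalIntegral.integral_add_adjacent_intervals (hgi _ _) (hgi _ _),
    intervalIntegral.integral_add_adjacent_intervals (hgi _ _) (hgi _ _)]

lemma norm_fourier_smoothed_le (h : IsPhase f f₁ f₂ l) (hst : s ≤ t) (y : ℝ) :
    ‖𝓕 (smoothed f f₁ s t) y‖ ≤ 6 / √l + 2 := by
  rw [fourier_smoothed h hst]
  refine norm_add₃_le.trans ?_
  rw [norm_mul, norm_mul, norm_osc, norm_osc, one_mul, one_mul]
  linarith [(h.sub_linear y).norm_integral_le s t, norm_tentTransform_le_one (y - f₁ s),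
    norm_tentTransform_le_one (f₁ t - y)]

lemma norm_fourier_smoothed_le_of_ne (h : IsPhase f f₁ f₂ l) (hst : s ≤ t) {y : ℝ}
    (hy : y < f₁ s ∨ f₁ t < y) :
    ‖𝓕 (smoothed f f₁ s t) y‖ ≤
      (1 / (f₁ s - y) - 1 / (f₁ t - y)) + 1 / (f₁ s - y) ^ 2 + 1 / (f₁ t - y) ^ 2 := by
  have hne : ∀ x ∈ Set.Icc s t, f₁ x - y ≠ 0 := by
    intro x hx
    have h1 := h.monotone hx.1
    have h2 := h.monotone hx.2
    rcases hy with hy | hy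
    · exact (sub_pos.2 (by linarith)).ne'
    · exact (sub_neg.2 (by linarith)).ne
  have hs0 : y - f₁ s ≠ 0 := by rw [← neg_sub]; exact neg_ne_zero.2 (hne s ⟨le_rfl, hst⟩)
  have ht0 := hne t ⟨hst, le_rfl⟩
  have h1 := (h.sub_linear y).norm_integral_sub_boundary_le hst hne
  have h2 := norm_tentTransform_add_le hs0
  have h3 := norm_tentTransform_add_le ht0
  rw [fourier_smoothed h hst]
  set I := ∫ x in s..t, osc (f x - y * x)
  set c : ℂ := 2 * Real.pi * Complex.I
  have hb : (c * ((y - f₁ s : ℝ) : ℂ)) = -(c * ((f₁ s - y : ℝ) : ℂ)) := by push_cast; ring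
  have e : osc (f s - y * s) * tentTransform (y - f₁ s) + I +
      osc (f t - y * t) * tentTransform (f₁ t - y) =
      (I - (osc (f t - y * t) / (c * ((f₁ t - y : ℝ) : ℂ)) -
        osc (f s - y * s) / (c * ((f₁ s - y : ℝ) : ℂ)))) +
      osc (f s - y * s) * (tentTransform (y - f₁ s) + 1 / (c * ((y - f₁ s : ℝ) : ℂ))) +
      osc (f t - y * t) * (tentTransform (f₁ t - y) + 1 / (c * ((f₁ t - y : ℝ) : ℂ))) := by
    rw [hb, div_neg]
    ring
  rw [e]
  refine norm_add₃_le.trans ?_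
  rw [norm_mul, norm_mul, norm_osc, norm_osc, one_mul, one_mul]
  have e2 : (y - f₁ s) ^ 2 = (f₁ s - y) ^ 2 := by ring
  rw [e2] at h2
  linarith

lemma one_div_sub_one_div_add_le {D j d : ℝ} (hD : 0 ≤ D) (hj : 0 < j) (hd : j ≤ d) :
    1 / d - 1 / (d + D) ≤ 1 / j - 1 / (j + D) := by
  have hd0 := hj.trans_le hd
  have e : ∀ x : ℝ, 0 < x → 1 / x - 1 / (x + D) = D / (x * (x + D)) := by
    intro x hx; field_simp; ring
  rw [e d hd0, e j hj]
  gcongr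

/-- Majorant for the Fourier coefficients whose frequency lies outside the range of `f'`. -/
noncomputable def outerBound (l D : ℝ) : ℕ → ℝ
  | 0 => 6 / √l + 2
  | j + 1 => (1 / ((j : ℝ) + 1) - 1 / ((j : ℝ) + 1 + D)) + 2 * (1 / ((j : ℝ) + 1) ^ 2)

lemma sum_outerBound_le {D : ℝ} (hD : 0 ≤ D) (n : ℕ) :
    ∑ j ∈ Finset.range n, outerBound l D j ≤ 6 / √l + 7 + Real.log (1 + D) := by
  rcases n with _ | n
  · have := Real.log_nonneg (show (1 : ℝ) ≤ 1 + D by linarith)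
    have : 0 ≤ 6 / √l := by positivity
    simp; linarith
  · rw [Finset.sum_range_succ']
    simp only [outerBound]
    rw [Finset.sum_add_distrib, ← Finset.mul_sum]
    linarith [sum_one_div_sub_le hD n, sum_one_div_sq_le n]

lemma norm_le_outerBound (h : IsPhase f f₁ f₂ l) (hst : s ≤ t) {y : ℝ} (j : ℕ)
    (hy : y ≤ f₁ s - j ∨ f₁ t + j ≤ y) :
    ‖𝓕 (smoothed f f₁ s t) y‖ ≤ outerBound l (f₁ t - f₁ s) j := by
  rcases j with _ | j
  · exact norm_fourier_smoothed_le h hst y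
  have hD : 0 ≤ f₁ t - f₁ s := sub_nonneg.2 (h.monotone hst)
  have hj : (0 : ℝ) ≤ j := j.cast_nonneg
  push_cast at hy
  have hj1 : (0 : ℝ) < (j : ℝ) + 1 := by linarith
  have hsq : ∀ z : ℝ, (j : ℝ) + 1 ≤ |z| → 1 / z ^ 2 ≤ 1 / ((j : ℝ) + 1) ^ 2 := by
    intro z hz
    rw [← sq_abs z]
    gcongr
  rw [outerBound]
  rcases hy with hy | hy
  · refine (norm_fourier_smoothed_le_of_ne h hst (Or.inl (by linarith))).trans ?_
    have h1 := one_div_sub_one_div_add_le (d := f₁ s - y) hD hj1 (by linarith)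
    rw [show f₁ s - y + (f₁ t - f₁ s) = f₁ t - y by ring] at h1
    linarith [hsq (f₁ s - y) (by rw [abs_of_nonneg] <;> linarith),
      hsq (f₁ t - y) (by rw [abs_of_nonneg] <;> linarith)]
  · refine (norm_fourier_smoothed_le_of_ne h hst (Or.inr (by linarith))).trans ?_
    have h1 := one_div_sub_one_div_add_le (d := y - f₁ t) hD hj1 (by linarith)
    rw [show y - f₁ t + (f₁ t - f₁ s) = y - f₁ s by ring] at h1
    have e1 : 1 / (f₁ s - y) = -(1 / (y - f₁ s)) := by rw [← neg_sub, div_neg]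
    have e2 : 1 / (f₁ t - y) = -(1 / (y - f₁ t)) := by rw [← neg_sub, div_neg]
    rw [e1, e2]
    linarith [hsq (f₁ s - y) (by rw [abs_of_nonpos] <;> linarith),
      hsq (f₁ t - y) (by rw [abs_of_nonpos] <;> linarith)]

lemma tsum_smoothed (h : IsPhase f f₁ f₂ l)
    (hs : Summable fun n : ℤ => 𝓕 (smoothed f f₁ s t) n) :
    ∑' n : ℤ, smoothed f f₁ s t n = ∑' n : ℤ, 𝓕 (smoothed f f₁ s t) n := by
  have hO : smoothed f f₁ s t =O[cocompact ℝ] fun x : ℝ => |x| ^ (-2 : ℝ) := by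
    refine Asymptotics.IsBigO.congr' (Asymptotics.isBigO_zero _ _) ?_ EventuallyEq.rfl
    have : (Set.Icc (s - 1) (t + 1))ᶜ ∈ cocompact ℝ := isCompact_Icc.compl_mem_cocompact
    filter_upwards [this] with x hx
    exact (smoothed_eq_zero fun hx' => hx (Set.Ioo_subset_Icc_self hx')).symm
  simpa using Real.tsum_eq_tsum_fourier_of_rpow_decay_of_summable (continuous_smoothed h)
    one_lt_two hO hs 0

lemma norm_tsum_smoothed_sub_le (hst : s ≤ t) :
    ‖(∑' n : ℤ, smoothed f f₁ s t n) - ∑ k ∈ Finset.Icc ⌈s⌉ ⌊t⌋, osc (f k)‖ ≤ 2 := by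
  have hpq : ⌈s⌉ ≤ ⌊t⌋ + 1 := by
    rw [Int.ceil_le]; push_cast; linarith [Int.lt_floor_add_one t]
  have h1 := (summable_and_norm_tsum_sub_le (h := fun n : ℤ => smoothed f f₁ s t n) hpq
    (b := fun j => if j = 0 then 1 else 0) (B := 1) (fun j => ?_) (fun j => ?_)
    (fun n => ?_)).2
  · have e : ∑ k ∈ Finset.Icc ⌈s⌉ ⌊t⌋, osc (f k) =
        ∑ k ∈ Finset.Icc ⌈s⌉ ⌊t⌋, smoothed f f₁ s t k := by
      refine Finset.sum_congr rfl fun k hk => ?_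
      rw [Finset.mem_Icc, Int.ceil_le, Int.le_floor] at hk
      rw [smoothed_of_mem hk]
    rw [e]; linarith
  · rcases j with _ | j
    · simpa using norm_smoothed_le _
    · rw [smoothed_eq_zero]
      · simp
      · intro hx
        have := hx.2
        push_cast at this
        linarith [Int.lt_floor_add_one t, (j.cast_nonneg : (0 : ℝ) ≤ j)]
  · rcases j with _ | j
    · simpa using norm_smoothed_le _
    · rw [smoothed_eq_zero]
      · simp
      · intro hx
        have := hx.1
        push_cast at this
        linarith [Int.ceil_lt_add_one s, (j.cast_nonneg : (0 : ℝ) ≤ j)]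
  · rw [Finset.sum_ite_eq']
    split_ifs <;> norm_num

/-- Truncated Poisson summation. -/
lemma norm_sum_sub_sum_integral_le (h : IsPhase f f₁ f₂ l) (hst : s ≤ t) :
    ‖(∑ k ∈ Finset.Icc ⌈s⌉ ⌊t⌋, osc (f k)) -
      ∑ m ∈ Finset.Icc ⌈f₁ s⌉ ⌊f₁ t⌋, ∫ x in s..t, osc (f x - m * x)‖ ≤
      12 / √l + 22 + 6 * Real.log (1 + (f₁ t - f₁ s)) := by
  have hmono := h.monotone hst
  have hD : 0 ≤ f₁ t - f₁ s := sub_nonneg.2 hmono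
  have hpq : ⌈f₁ s⌉ ≤ ⌊f₁ t⌋ + 1 := by
    rw [Int.ceil_le]; push_cast; linarith [Int.lt_floor_add_one (f₁ t)]
  obtain ⟨hs, h1⟩ := summable_and_norm_tsum_sub_le
    (h := fun n : ℤ => 𝓕 (smoothed f f₁ s t) (n : ℝ)) hpq
    (b := outerBound l (f₁ t - f₁ s)) (B := 6 / √l + 7 + Real.log (1 + (f₁ t - f₁ s)))
    (fun j => norm_le_outerBound h hst j (Or.inr (by
      push_cast; linarith [Int.lt_floor_add_one (f₁ t)])))
    (fun j => norm_le_outerBound h hst j (Or.inl (by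
      push_cast; linarith [Int.ceil_lt_add_one (f₁ s)])))
    (sum_outerBound_le hD)
  have h2 := norm_tsum_smoothed_sub_le (f := f) (f₁ := f₁) hst
  rw [tsum_smoothed h hs] at h2
  have hqp : (⌊f₁ t⌋ : ℝ) - ⌈f₁ s⌉ ≤ f₁ t - f₁ s := by
    linarith [Int.floor_le (f₁ t), Int.le_ceil (f₁ s)]
  have hr := sum_Icc_le_right (h := fun m => ‖tentTransform (f₁ t - m)‖) (M := 1) (a := 0)
    (c := 2) zero_le_one le_rfl zero_le_two hD hqp (fun _ => norm_tentTransform_le_one _)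
    (fun j hj _ => by
      have hj' : (1 : ℝ) ≤ j := by exact_mod_cast hj
      have hle : (j : ℝ) ≤ f₁ t - ((⌊f₁ t⌋ - j : ℤ) : ℝ) := by
        push_cast; linarith [Int.floor_le (f₁ t)]
      refine (norm_tentTransform_le (by linarith)).trans ?_
      rw [zero_add, abs_of_nonneg (by linarith)]
      gcongr)
  have hl := sum_Icc_le_left (h := fun m => ‖tentTransform (m - f₁ s)‖) (M := 1) (a := 0)
    (c := 2) zero_le_one le_rfl zero_le_two hD hqp (fun _ => norm_tentTransform_le_one _)
    (fun j hj _ => by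
      have hj' : (1 : ℝ) ≤ j := by exact_mod_cast hj
      have hle : (j : ℝ) ≤ ((⌈f₁ s⌉ + j : ℤ) : ℝ) - f₁ s := by
        push_cast; linarith [Int.le_ceil (f₁ s)]
      refine (norm_tentTransform_le (by linarith)).trans ?_
      rw [zero_add, abs_of_nonneg (by linarith)]
      gcongr)
  have h3 : ‖(∑ m ∈ Finset.Icc ⌈f₁ s⌉ ⌊f₁ t⌋, 𝓕 (smoothed f f₁ s t) (m : ℝ)) -
      ∑ m ∈ Finset.Icc ⌈f₁ s⌉ ⌊f₁ t⌋, ∫ x in s..t, osc (f x - m * x)‖ ≤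
      ∑ m ∈ Finset.Icc ⌈f₁ s⌉ ⌊f₁ t⌋, ‖tentTransform (m - f₁ s)‖ +
      ∑ m ∈ Finset.Icc ⌈f₁ s⌉ ⌊f₁ t⌋, ‖tentTransform (f₁ t - m)‖ := by
    rw [← Finset.sum_sub_distrib, ← Finset.sum_add_distrib]
    refine norm_sum_le_of_le _ fun m _ => ?_
    rw [fourier_smoothed h hst, add_right_comm, add_sub_cancel_right]
    refine (norm_add_le _ _).trans ?_
    rw [norm_mul, norm_mul, norm_osc, norm_osc, one_mul, one_mul]
  have h4 := norm_sub_le_norm_sub_add_norm_sub (∑ k ∈ Finset.Icc ⌈s⌉ ⌊t⌋, osc (f k))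
    (∑' n : ℤ, 𝓕 (smoothed f f₁ s t) (n : ℝ))
    (∑ m ∈ Finset.Icc ⌈f₁ s⌉ ⌊f₁ t⌋, ∫ x in s..t, osc (f x - m * x))
  have h5 := norm_sub_le_norm_sub_add_norm_sub (∑' n : ℤ, 𝓕 (smoothed f f₁ s t) (n : ℝ))
    (∑ m ∈ Finset.Icc ⌈f₁ s⌉ ⌊f₁ t⌋, 𝓕 (smoothed f f₁ s t) (m : ℝ))
    (∑ m ∈ Finset.Icc ⌈f₁ s⌉ ⌊f₁ t⌋, ∫ x in s..t, osc (f x - m * x))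
  rw [norm_sub_rev] at h2
  have e : 12 / √l = 2 * (6 / √l) := by ring
  rw [e]
  linarith

end Poisson

section Saddles

variable {f f₁ f₂ : ℝ → ℝ} {l s t B K δ : ℝ} {x : ℤ → ℝ}

lemma norm_sum_integral_sub_sum_saddle_le (h : IsPhase f f₁ f₂ l) (hB : ∀ y, f₂ y ≤ B * l)
    (hB0 : 0 ≤ B) (hK0 : 0 ≤ K) (hK : ∀ y z, |f₂ y - f₂ z| ≤ K * |y - z|) (hst : s ≤ t)
    (hδ : 0 < δ)
    (hx : ∀ m : ℤ, f₁ s ≤ m → m ≤ f₁ t → x m ∈ Set.Icc s t ∧ f₁ (x m) = m) :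
    ‖(∑ m ∈ Finset.Icc ⌈f₁ s⌉ ⌊f₁ t⌋, ∫ y in s..t, osc (f y - m * y)) -
      Complex.exp (Real.pi * Complex.I / 4) * ∑ m ∈ Finset.Icc ⌈f₁ s⌉ ⌊f₁ t⌋,
        osc (f (x m) - m * x m) / (√(f₂ (x m)) : ℂ)‖ ≤
      2 * (4 / √l + (f₁ t - f₁ s) * (3 / (l * δ) + 7 * K * δ ^ 4) +
        B * (1 + Real.log (1 + (f₁ t - f₁ s)))) := by
  have hD : 0 ≤ f₁ t - f₁ s := sub_nonneg.2 (h.monotone hst)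
  have hl := h.pos
  have hqp : (⌊f₁ t⌋ : ℝ) - ⌈f₁ s⌉ ≤ f₁ t - f₁ s := by
    linarith [Int.floor_le (f₁ t), Int.le_ceil (f₁ s)]
  have hx' : ∀ m : ℤ, ⌈f₁ s⌉ ≤ m → m ≤ ⌊f₁ t⌋ → x m ∈ Set.Icc s t ∧ f₁ (x m) = m :=
    fun m h1 h2 => hx m (Int.ceil_le.1 h1) (Int.le_floor.1 h2)
  set S : ℤ → ℂ := fun m => osc (f (x m) - m * x m) *
    (Complex.exp (Real.pi * Complex.I / 4) / (2 * (√(f₂ (x m)) : ℂ))) with hS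
  have hr := sum_Icc_le_right (h := fun m : ℤ => ‖(∫ y in (x m)..t, osc (f y - m * y)) - S m‖)
    (p := ⌈f₁ s⌉) (q := ⌊f₁ t⌋) (M := 4 / √l) (a := 3 / (l * δ) + 7 * K * δ ^ 4)
    (c := B) (by positivity) (by positivity) hB0 hD hqp
    (fun hle => by
      obtain ⟨hm, hm'⟩ := hx' _ hle le_rfl
      exact (h.sub_linear _).norm_stationary_phase_le_const (by rw [hm', sub_self]) hm.2)
    (fun j hj hp => by
      have hj' : (1 : ℝ) ≤ j := by exact_mod_cast hj
      obtain ⟨hm, hm'⟩ := hx' (⌊f₁ t⌋ - j) hp (by omega)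
      have hle : (j : ℝ) ≤ f₁ t - ((⌊f₁ t⌋ - j : ℤ) : ℝ) := by
        push_cast; linarith [Int.floor_le (f₁ t)]
      have hlt : x (⌊f₁ t⌋ - j) < t := by
        refine lt_of_le_of_ne hm.2 fun he => ?_
        rw [he] at hm'
        linarith
      refine ((h.sub_linear _).norm_stationary_phase_le hB hK0 hK
        (by rw [hm', sub_self]) hlt hδ).trans ?_
      gcongr)
  have hl := sum_Icc_le_left (h := fun m : ℤ => ‖(∫ y in s..(x m), osc (f y - m * y)) - S m‖)
    (p := ⌈f₁ s⌉) (q := ⌊f₁ t⌋) (M := 4 / √l) (a := 3 / (l * δ) + 7 * K * δ ^ 4)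
    (c := B) (by positivity) (by positivity) hB0 hD hqp
    (fun hle => by
      obtain ⟨hm, hm'⟩ := hx' _ le_rfl hle
      have := (h.sub_linear (⌈f₁ s⌉ : ℝ)).reflect.norm_stationary_phase_le_const
        (c := -x ⌈f₁ s⌉) (t := -s) (by simp [hm']) (by linarith [hm.1])
      rw [IsPhase.integral_reflect (F := fun y => f y - (⌈f₁ s⌉ : ℝ) * y)] at this
      simpa only [neg_neg, hS] using this)
    (fun j hj hp => by
      have hj' : (1 : ℝ) ≤ j := by exact_mod_cast hj
      obtain ⟨hm, hm'⟩ := hx' (⌈f₁ s⌉ + j) (by omega) hp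
      have hle : (j : ℝ) ≤ ((⌈f₁ s⌉ + j : ℤ) : ℝ) - f₁ s := by
        push_cast; linarith [Int.le_ceil (f₁ s)]
      have hlt : s < x (⌈f₁ s⌉ + j) := by
        refine lt_of_le_of_ne hm.1 fun he => ?_
        rw [← he] at hm'
        linarith
      have := (h.sub_linear ((⌈f₁ s⌉ + j : ℤ) : ℝ)).reflect.norm_stationary_phase_le
        (B := B) (K := K) (c := -x (⌈f₁ s⌉ + j)) (t := -s) (δ := δ) (fun y => hB _) hK0
        (fun y z => by
          refine (hK _ _).trans (le_of_eq ?_)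
          rw [← abs_neg (y - z)]
          congr 2; ring)
        (by simp [hm']) (by linarith) hδ
      rw [IsPhase.integral_reflect (F := fun y => f y - ((⌈f₁ s⌉ + j : ℤ) : ℝ) * y)] at this
      simp only [neg_neg] at this
      refine this.trans ?_
      gcongr
      linarith)
  have hmain : ‖(∑ m ∈ Finset.Icc ⌈f₁ s⌉ ⌊f₁ t⌋, ∫ y in s..t, osc (f y - m * y)) -
      Complex.exp (Real.pi * Complex.I / 4) * ∑ m ∈ Finset.Icc ⌈f₁ s⌉ ⌊f₁ t⌋,
        osc (f (x m) - m * x m) / (√(f₂ (x m)) : ℂ)‖ ≤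
      ∑ m ∈ Finset.Icc ⌈f₁ s⌉ ⌊f₁ t⌋, ‖(∫ y in s..(x m), osc (f y - m * y)) - S m‖ +
      ∑ m ∈ Finset.Icc ⌈f₁ s⌉ ⌊f₁ t⌋, ‖(∫ y in (x m)..t, osc (f y - m * y)) - S m‖ := by
    rw [Finset.mul_sum, ← Finset.sum_sub_distrib, ← Finset.sum_add_distrib]
    refine norm_sum_le_of_le _ fun m _ => ?_
    have hi := (h.sub_linear (m : ℝ)).intervalIntegrable
    rw [← intervalIntegral.integral_add_adjacent_intervals (hi s (x m)) (hi (x m) t)]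
    refine le_trans (le_of_eq ?_) (norm_add_le _ _)
    congr 1
    simp only [hS]
    have h0 : (√(f₂ (x m)) : ℂ) ≠ 0 := by
      exact_mod_cast (Real.sqrt_pos.2 (h.pos.trans_le (h.le (x m)))).ne'
    field_simp
    ring
  linarith

lemma exists_balancing_length {l r : ℝ} (hl : 0 < l) (hr : 0 < r) :
    ∃ δ : ℝ, 0 < δ ∧ l * (1 / (l * δ)) = l ^ ((1 : ℝ) / 5) * r ^ ((1 : ℝ) / 5) ∧
      l * (r * δ ^ 4) = l ^ ((1 : ℝ) / 5) * r ^ ((1 : ℝ) / 5) := by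
  set a := l ^ ((1 : ℝ) / 5) with ha
  set b := r ^ ((1 : ℝ) / 5) with hb
  have ha0 : 0 < a := Real.rpow_pos_of_pos hl _
  have hb0 : 0 < b := Real.rpow_pos_of_pos hr _
  have hla : l = a ^ 5 := by
    rw [ha, ← Real.rpow_natCast, ← Real.rpow_mul hl.le]; norm_num
  have hrb : r = b ^ 5 := by
    rw [hb, ← Real.rpow_natCast, ← Real.rpow_mul hr.le]; norm_num
  refine ⟨1 / (a * b), by positivity, ?_, ?_⟩
  · rw [hla]; field_simp
  · rw [hla, hrb]; field_simp

/-- The van der Corput iteration for a phase defined on the whole line. -/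
lemma norm_sum_sub_sum_saddle_le {r : ℝ} (h : IsPhase f f₁ f₂ l) (hB : ∀ y, f₂ y ≤ B * l)
    (hB1 : 1 ≤ B) (hr : 0 < r) (hK : ∀ y z, |f₂ y - f₂ z| ≤ B * r * |y - z|) (hst : s ≤ t)
    (hx : ∀ m : ℤ, f₁ s ≤ m → m ≤ f₁ t → x m ∈ Set.Icc s t ∧ f₁ (x m) = m) :
    ‖(∑ k ∈ Finset.Icc ⌈s⌉ ⌊t⌋, osc (f k)) -
      Complex.exp (Real.pi * Complex.I / 4) * ∑ m ∈ Finset.Icc ⌈f₁ s⌉ ⌊f₁ t⌋,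
        osc (f (x m) - m * x m) / (√(f₂ (x m)) : ℂ)‖ ≤
      (100 + 40 * B ^ 2) * (l ^ (-(1 : ℝ) / 2) + Real.log (2 + (t - s) * l) +
            (t - s) * l ^ ((1 : ℝ) / 5) * r ^ ((1 : ℝ) / 5)) := by
  have hl := h.pos
  have hB0 : 0 < B := by linarith
  obtain ⟨δ, hδ, h1, h2⟩ := exists_balancing_length hl hr
  have h3 := norm_sum_integral_sub_sum_saddle_le h hB hB0.le (by positivity) hK hst hδ hx
  have h4 := norm_sum_sub_sum_integral_le h hst
  have h5 := norm_sub_le_norm_sub_add_norm_sub (∑ k ∈ Finset.Icc ⌈s⌉ ⌊t⌋, osc (f k))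
    (∑ m ∈ Finset.Icc ⌈f₁ s⌉ ⌊f₁ t⌋, ∫ y in s..t, osc (f y - m * y))
    (Complex.exp (Real.pi * Complex.I / 4) * ∑ m ∈ Finset.Icc ⌈f₁ s⌉ ⌊f₁ t⌋,
        osc (f (x m) - m * x m) / (√(f₂ (x m)) : ℂ))
  refine h5.trans ((add_le_add h4 h3).trans ?_)
  have hD : f₁ t - f₁ s ≤ B * ((t - s) * l) := by
    have hd : Differentiable ℝ f₁ := fun x => (h.deriv₁ x).differentiableAt
    have := image_sub_le_mul_sub_of_deriv_le hd
      (C := B * l) (fun z => by rw [(h.deriv₁ z).deriv]; exact hB z) hst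
    linarith
  have hD0 : 0 ≤ f₁ t - f₁ s := sub_nonneg.2 (h.monotone hst)
  have hX : 0 ≤ (t - s) * l := mul_nonneg (sub_nonneg.2 hst) hl.le
  have hE : (f₁ t - f₁ s) * (3 / (l * δ) + 7 * (B * r) * δ ^ 4) ≤
      B * (3 + 7 * B) * ((t - s) * l ^ ((1 : ℝ) / 5) * r ^ ((1 : ℝ) / 5)) := by
    calc _ ≤ B * ((t - s) * l) * (3 / (l * δ) + 7 * (B * r) * δ ^ 4) := by gcongr
      _ = B * (t - s) * (3 * (l * (1 / (l * δ))) + 7 * B * (l * (r * δ ^ 4))) := by ring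
      _ = _ := by rw [h1, h2]; ring
  have hlog : Real.log (1 + (f₁ t - f₁ s)) ≤ B + Real.log (2 + (t - s) * l) := by
    calc _ ≤ Real.log (B * (2 + (t - s) * l)) := by
          refine Real.log_le_log (by linarith) ?_
          nlinarith
      _ = Real.log B + Real.log (2 + (t - s) * l) := Real.log_mul hB0.ne' (by linarith)
      _ ≤ _ := by linarith [Real.log_le_sub_one_of_pos hB0]
  have hL : 1 / 2 ≤ Real.log (2 + (t - s) * l) := by
    have := Real.log_le_log two_pos (show 2 ≤ 2 + (t - s) * l by linarith)
    linarith [Real.log_two_gt_d9]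
  have hsq : l ^ (-(1 : ℝ) / 2) = 1 / √l := by
    rw [Real.sqrt_eq_rpow, neg_div, Real.rpow_neg hl.le, one_div (l ^ _)]
  rw [hsq]
  set L := Real.log (2 + (t - s) * l)
  set G := (t - s) * l ^ ((1 : ℝ) / 5) * r ^ ((1 : ℝ) / 5)
  have hG : 0 ≤ G := by
    have : 0 ≤ t - s := sub_nonneg.2 hst
    positivity
  have hV : 0 ≤ 1 / √l := by positivity
  have e1 : 12 / √l = 12 * (1 / √l) := by ring
  have e2 : 4 / √l = 4 * (1 / √l) := by ring
  rw [e1, e2]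
  have hBB : B ≤ B ^ 2 := by nlinarith
  have k1 : B * Real.log (1 + (f₁ t - f₁ s)) ≤ B * (B + L) := by gcongr
  have k2 : 0 ≤ B ^ 2 * (1 / √l) := by positivity
  have k3 : B * L ≤ B ^ 2 * L := by gcongr
  have k4 : B ^ 2 * (1 / 2) ≤ B ^ 2 * L := by gcongr
  have k5 : B * G ≤ B ^ 2 * G := by gcongr
  nlinarith

end Saddles

section Extension

variable {s t l r A : ℝ} {f f' f'' f''' : ℝ → ℝ}

/-- A phase given on an interval extends to the whole line with the same bounds. -/
lemma exists_extension (hst : s < t)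
    (hf : ∀ y ∈ Set.Icc s t, HasDerivWithinAt f (f' y) (Set.Icc s t) y)
    (hf' : ∀ y ∈ Set.Icc s t, HasDerivWithinAt f' (f'' y) (Set.Icc s t) y)
    (hf'' : ∀ y ∈ Set.Icc s t, HasDerivWithinAt f'' (f''' y) (Set.Icc s t) y)
    (hl : 0 < l) (hr : 0 ≤ r) (h2 : ∀ y ∈ Set.Icc s t, l ≤ f'' y ∧ f'' y ≤ A)
    (h3 : ∀ y ∈ Set.Icc s t, |f''' y| ≤ r) :
    ∃ F F₁ F₂ : ℝ → ℝ, IsPhase F F₁ F₂ l ∧ (∀ y, F₂ y ≤ A) ∧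
      (∀ y z, |F₂ y - F₂ z| ≤ r * |y - z|) ∧ Set.EqOn F f (Set.Icc s t) ∧
      Set.EqOn F₁ f' (Set.Icc s t) ∧ Set.EqOn F₂ f'' (Set.Icc s t) := by
  set F₂ : ℝ → ℝ := Set.IccExtend hst.le (Set.domRestrict (Set.Icc s t) f'') with hF₂
  have hc : Continuous F₂ :=
    Continuous.Icc_extend' (continuousOn_iff_continuous_domRestrict.1
      fun y hy => (hf'' y hy).continuousWithinAt)
  set F₁ : ℝ → ℝ := fun y => f' s + ∫ z in s..y, F₂ z with hF₁
  have hd₁ : ∀ y, HasDerivAt F₁ (F₂ y) y := fun y =>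
    (intervalIntegral.integral_hasDerivAt_right (hc.intervalIntegrable _ _)
      hc.aestronglyMeasurable.stronglyMeasurableAtFilter hc.continuousAt).const_add _
  have hc₁ : Continuous F₁ := continuous_iff_continuousAt.2 fun y => (hd₁ y).continuousAt
  set F : ℝ → ℝ := fun y => f s + ∫ z in s..y, F₁ z with hF
  have hd : ∀ y, HasDerivAt F (F₁ y) y := fun y =>
    (intervalIntegral.integral_hasDerivAt_right (hc₁.intervalIntegrable _ _)
      hc₁.aestronglyMeasurable.stronglyMeasurableAtFilter hc₁.continuousAt).const_add _
  have key : ∀ g g' G : ℝ → ℝ, Continuous G →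
      (∀ y ∈ Set.Icc s t, HasDerivWithinAt g (g' y) (Set.Icc s t) y) →
      Set.EqOn G g' (Set.Icc s t) → Set.EqOn (fun y => g s + ∫ z in s..y, G z) g (Set.Icc s t) := by
    intro g g' G hG hg hGg y hy
    have := intervalIntegral.integral_eq_sub_of_hasDerivAt_of_le (f := g) (f' := G) hy.1
      (fun z hz => (hg z ⟨hz.1, hz.2.trans hy.2⟩).continuousWithinAt.mono
        (Set.Icc_subset_Icc_right hy.2))
      (fun z hz => by
        have hz' : z ∈ Set.Icc s t := ⟨hz.1.le, hz.2.le.trans hy.2⟩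
        rw [hGg hz']
        exact (hg z hz').hasDerivAt (Icc_mem_nhds hz.1 (hz.2.trans_le hy.2)))
      (hG.intervalIntegrable _ _)
    simp only [this]
    ring
  have hE₂ : Set.EqOn F₂ f'' (Set.Icc s t) := fun y hy => by
    rw [hF₂, Set.IccExtend_of_mem _ _ hy, Set.domRestrict_apply]
  have hE₁ : Set.EqOn F₁ f' (Set.Icc s t) := key f' f'' F₂ hc hf' hE₂
  have hE : Set.EqOn F f (Set.Icc s t) := key f f' F₁ hc₁ hf hE₁
  refine ⟨F, F₁, F₂, ⟨hl, hd, hd₁, hc, fun y => (h2 _ (Set.projIcc s t hst.le y).2).1⟩,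
    fun y => (h2 _ (Set.projIcc s t hst.le y).2).2, fun y z => ?_, hE, hE₁, hE₂⟩
  have h4 := Convex.norm_image_sub_le_of_norm_hasDerivWithin_le hf'' h3 (convex_Icc s t)
    (Set.projIcc s t hst.le z).2 (Set.projIcc s t hst.le y).2
  refine h4.trans ?_
  gcongr
  exact Set.abs_projIcc_sub_projIcc hst.le

end Extension

end VanDerCorput

/-- The van der Corput iteration (Theorem 3.1): the exponential sum
`∑_{s ≤ k ≤ t} e^{2πi f(k)}` is transformed into a sum over the saddle points
`x_m` (solutions of `f'(x) = m`), with an explicit error bound. -/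
theorem van_der_corput_iteration :
    ∀ A : ℝ, 0 < A → ∃ C : ℝ, 0 < C ∧
      ∀ (s t : ℝ) (f f' f'' f''' : ℝ → ℝ) (lam2 lam3 : ℝ) (x : ℤ → ℝ),
        s < t →
        (∀ y ∈ Set.Icc s t, HasDerivWithinAt f (f' y) (Set.Icc s t) y) →
        (∀ y ∈ Set.Icc s t, HasDerivWithinAt f' (f'' y) (Set.Icc s t) y) →
        (∀ y ∈ Set.Icc s t, HasDerivWithinAt f'' (f''' y) (Set.Icc s t) y) →
        ContinuousOn f''' (Set.Icc s t) →
        ContinuousOn f' (Set.Icc s t) →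
        StrictMonoOn f' (Set.Icc s t) →
        0 < lam2 → 0 < lam3 →
        (∀ y ∈ Set.Icc s t, lam2 < |f'' y| ∧ |f'' y| < A * lam2) →
        (∀ y ∈ Set.Icc s t, |f''' y| < A * lam3) →
        (∀ m : ℤ, f' s ≤ (m : ℝ) → (m : ℝ) ≤ f' t →
            x m ∈ Set.Icc s t ∧ f' (x m) = (m : ℝ)) →
        ‖(∑ k ∈ Finset.Icc ⌈s⌉ ⌊t⌋,
              Complex.exp (2 * Real.pi * Complex.I * ((f (k : ℝ) : ℝ) : ℂ))) -
            Complex.exp (Real.pi * Complex.I / 4) *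
              ∑ m ∈ Finset.Icc ⌈f' s⌉ ⌊f' t⌋,
                Complex.exp (2 * Real.pi * Complex.I *
                    ((f (x m) - (m : ℝ) * x m : ℝ) : ℂ)) /
                  (Real.sqrt |f'' (x m)| : ℂ)‖ ≤
          C * (lam2 ^ (-(1 : ℝ) / 2) + Real.log (2 + (t - s) * lam2) +
            (t - s) * lam2 ^ ((1 : ℝ) / 5) * lam3 ^ ((1 : ℝ) / 5)) := by
  intro A hA
  refine ⟨100 + 40 * A ^ 2, by positivity, ?_⟩
  intro s t f f' f'' f''' lam2 lam3 x hst hf hf' hf'' _ _ hmono hl2 hl3 h2 h3 hx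
  have hs : s ∈ Set.Icc s t := ⟨le_rfl, hst.le⟩
  have ht : t ∈ Set.Icc s t := ⟨hst.le, le_rfl⟩
  have hpos : ∀ y ∈ Set.Icc s t, |f'' y| = f'' y := fun y hy => by
    have h := hmono.monotoneOn.derivWithin_nonneg (x := y)
    rw [(hf' y hy).derivWithin (uniqueDiffOn_Icc hst y hy)] at h
    exact abs_of_nonneg h
  have hA1 : 1 ≤ A := by
    obtain ⟨h4, h5⟩ := h2 s hs
    nlinarith
  obtain ⟨F, F₁, F₂, hF, hFA, hFr, hE, hE₁, hE₂⟩ :=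
    VanDerCorput.exists_extension (l := lam2) (r := A * lam3) (A := A * lam2) hst hf hf' hf'' hl2
      (by positivity)
      (fun y hy => by
        have := h2 y hy
        rw [hpos y hy] at this
        exact ⟨this.1.le, this.2.le⟩)
      (fun y hy => (h3 y hy).le)
  have hxF : ∀ m : ℤ, F₁ s ≤ m → m ≤ F₁ t → x m ∈ Set.Icc s t ∧ F₁ (x m) = m := by
    intro m hm1 hm2
    rw [hE₁ hs] at hm1
    rw [hE₁ ht] at hm2
    obtain ⟨h4, h5⟩ := hx m hm1 hm2
    exact ⟨h4, by rw [hE₁ h4, h5]⟩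
  have main := VanDerCorput.norm_sum_sub_sum_saddle_le hF hFA hA1 hl3 hFr hst.le hxF
  rw [hE₁ hs, hE₁ ht] at main
  have e1 : ∑ k ∈ Finset.Icc ⌈s⌉ ⌊t⌋, VanDerCorput.osc (F k) =
      ∑ k ∈ Finset.Icc ⌈s⌉ ⌊t⌋,
        Complex.exp (2 * Real.pi * Complex.I * ((f (k : ℝ) : ℝ) : ℂ)) := by
    refine Finset.sum_congr rfl fun k hk => ?_
    rw [Finset.mem_Icc, Int.ceil_le, Int.le_floor] at hk
    rw [hE hk, VanDerCorput.osc]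
  have e2 : ∑ m ∈ Finset.Icc ⌈f' s⌉ ⌊f' t⌋,
        VanDerCorput.osc (F (x m) - m * x m) / (√(F₂ (x m)) : ℂ) =
      ∑ m ∈ Finset.Icc ⌈f' s⌉ ⌊f' t⌋,
        Complex.exp (2 * Real.pi * Complex.I * ((f (x m) - (m : ℝ) * x m : ℝ) : ℂ)) /
          (Real.sqrt |f'' (x m)| : ℂ) := by
    refine Finset.sum_congr rfl fun m hm => ?_
    rw [Finset.mem_Icc, Int.ceil_le, Int.le_floor] at hm
    obtain ⟨h4, -⟩ := hx m hm.1 hm.2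
    rw [hE h4, hE₂ h4, hpos _ h4, VanDerCorput.osc]
  rwa [e1, e2] at main
end

section
/- Let ε ∈ (0, e^{−1}), let j ≥ 0 be an integer, let K be an integer with K > 50⁴·((j+1)·log(K/ε))⁶, let x be a real number with |x| ≤ 3/4, let c be a real number with |c|·K² ≤ 1/48, and set M := ⌈8·log(K/ε)⌉ and f(y) := (y^j/K^j)·exp(2πi c y³ + 2πi x y). Then |Σ_{n=0}^{K} f(n) − ∫_0^K f(y) dy − (1/2)(f(K) + f(0)) − Σ_{m=1}^{M} (B_{2m}/(2m)!)·(f^{(2m−1)}(K) − f^{(2m−1)}(0))| < ε, where B_{2m} are the even Bernoulli numbers and f^{(m)} denotes the m-th derivative of f with respect to y. -/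
/-- Even Bernoulli polynomials on the unit interval, normalised, are `O((2π)^{-2k})`. -/
theorem abs_bernoulliFun_div_factorial_le {k : ℕ} (hk : k ≠ 0) {t : ℝ}
    (ht : t ∈ Set.Icc (0 : ℝ) 1) :
    |bernoulliFun (2 * k) t / (2 * k).factorial| ≤ 4 / (2 * Real.pi) ^ (2 * k) := by
  have hcos : HasSum (fun n : ℕ => 1 / (n : ℝ) ^ (2 * k) * Real.cos (2 * Real.pi * n * t))
      ((-1 : ℝ) ^ (k + 1) * (2 * Real.pi) ^ (2 * k) / 2 / (2 * k).factorial *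
        bernoulliFun (2 * k) t) := hasSum_one_div_nat_pow_mul_cos hk ht
  have hbound (n : ℕ) : ‖1 / (n : ℝ) ^ (2 * k) * Real.cos (2 * Real.pi * n * t)‖
      ≤ 1 / (n : ℝ) ^ 2 := by
    rw [norm_mul, Real.norm_eq_abs, Real.norm_eq_abs,
      abs_of_nonneg (by positivity : (0 : ℝ) ≤ 1 / (n : ℝ) ^ (2 * k))]
    refine (mul_le_of_le_one_right (by positivity) (Real.abs_cos_le_one _)).trans ?_
    rcases Nat.eq_zero_or_pos n with rfl | hn
    · simp [hk]
    · have hn1 : (1 : ℝ) ≤ n := by exact_mod_cast hn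
      gcongr
      · omega
  have hle := hcos.norm_le_of_bounded hasSum_zeta_two hbound
  have hpi : Real.pi ^ 2 / 6 ≤ 2 := by nlinarith [Real.pi_lt_d2, Real.pi_pos]
  rw [le_div_iff₀ (by positivity), abs_div, Nat.abs_cast]
  have hnorm : ‖(-1 : ℝ) ^ (k + 1) * (2 * Real.pi) ^ (2 * k) / 2 / (2 * k).factorial *
        bernoulliFun (2 * k) t‖ =
      |bernoulliFun (2 * k) t| / (2 * k).factorial * (2 * Real.pi) ^ (2 * k) / 2 := by
    simp only [norm_mul, norm_div, norm_pow, norm_neg, norm_one, one_pow, one_mul,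
      Real.norm_eq_abs, abs_of_pos Real.pi_pos, Nat.abs_cast, abs_two]
    ring
  linarith [hnorm ▸ hle]

theorem hasDerivAt_bernoulliFun_div_factorial (k : ℕ) (t : ℝ) :
    HasDerivAt (fun s : ℝ => ((bernoulliFun (k + 1) s / (k + 1).factorial : ℝ) : ℂ))
      ((bernoulliFun k t / k.factorial : ℝ) : ℂ) t := by
  refine HasDerivAt.ofReal_comp ?_
  convert! (hasDerivAt_bernoulliFun (k + 1) t).div_const ((k + 1).factorial : ℝ) using 1
  rw [Nat.factorial_succ]
  push_cast
  field_simp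

/-- Integration by parts against a normalised Bernoulli polynomial. -/
theorem integral_bernoulliFun_mul_eq {u v : ℝ → ℂ} (k : ℕ)
    (hu : ∀ t, HasDerivAt u (v t) t) (hv : Continuous v) :
    ∫ t in (0 : ℝ)..1, ((bernoulliFun k t / k.factorial : ℝ) : ℂ) * u t =
      ((bernoulliFun (k + 1) 1 / (k + 1).factorial : ℝ) : ℂ) * u 1 -
      ((bernoulliFun (k + 1) 0 / (k + 1).factorial : ℝ) : ℂ) * u 0 -
      ∫ t in (0 : ℝ)..1, ((bernoulliFun (k + 1) t / (k + 1).factorial : ℝ) : ℂ) * v t := by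
  have hB (m : ℕ) : Continuous fun t : ℝ => ((bernoulliFun m t / m.factorial : ℝ) : ℂ) := by
    fun_prop
  have hparts := intervalIntegral.integral_mul_deriv_eq_deriv_mul (a := 0) (b := 1)
    (fun t _ => hasDerivAt_bernoulliFun_div_factorial k t) (fun t _ => hu t)
    ((hB k).intervalIntegrable _ _) (hv.intervalIntegrable _ _)
  rw [hparts]
  ring

/-- The Euler–Maclaurin formula on the unit interval. -/
theorem euler_maclaurin_unit_interval (G : ℕ → ℝ → ℂ)
    (hG : ∀ k t, HasDerivAt (G k) (G (k + 1) t) t) (M : ℕ) (hM : M ≠ 0) :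
    (G 0 0 + G 0 1) / 2 - (∫ t in (0 : ℝ)..1, G 0 t) -
      ∑ m ∈ Finset.Icc 1 M, ((bernoulli (2 * m) : ℚ) : ℂ) / ((2 * m).factorial : ℂ) *
        (G (2 * m - 1) 1 - G (2 * m - 1) 0) =
    -∫ t in (0 : ℝ)..1, ((bernoulliFun (2 * M) t / (2 * M).factorial : ℝ) : ℂ) * G (2 * M) t := by
  have hcont (k : ℕ) : Continuous (G k) :=
    continuous_iff_continuousAt.2 fun t => (hG k t).continuousAt
  have hstep (k : ℕ) := integral_bernoulliFun_mul_eq k (hG k) (hcont (k + 1))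
  have hend (k : ℕ) (hk : k ≠ 1) : bernoulliFun k 1 = (bernoulli k : ℝ) := by
    rw [bernoulliFun_endpoints_eq_of_ne_one hk, bernoulliFun_eval_zero]
  have h0 := hstep 0
  have h1 := hstep 1
  norm_num at h0
  rw [hend 2 (by norm_num), bernoulliFun_eval_zero] at h1
  induction M with
  | zero => exact absurd rfl hM
  | succ M ih =>
    rcases Nat.eq_zero_or_pos M with rfl | hpos
    · norm_num at h1 ⊢
      rw [h0, h1]
      ring
    · have ih := ih hpos.ne'
      have h2 := hstep (2 * M)
      have h3 := hstep (2 * M + 1)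
      rw [hend _ (by omega), bernoulliFun_eval_zero,
        bernoulli_eq_zero_of_odd ⟨M, rfl⟩ (by omega)] at h2
      rw [hend _ (by omega), bernoulliFun_eval_zero] at h3
      rw [Finset.sum_Icc_succ_top (by omega), ← sub_sub, ih, h2,
        show 2 * (M + 1) = 2 * M + 1 + 1 by ring, h3]
      push_cast
      ring

/-- The Euler–Maclaurin formula on `[0, K]` with a bound for the remainder. -/
theorem norm_euler_maclaurin_remainder_le (G : ℕ → ℝ → ℂ)
    (hG : ∀ k t, HasDerivAt (G k) (G (k + 1) t) t) (M K : ℕ) (hM : M ≠ 0) {C : ℝ}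
    (hC : ∀ t ∈ Set.Icc (0 : ℝ) K, ‖G (2 * M) t‖ ≤ C) :
    ‖(∑ n ∈ Finset.range (K + 1), G 0 n) - (∫ y in (0 : ℝ)..(K : ℝ), G 0 y) -
        (G 0 (K : ℝ) + G 0 0) / 2 -
        ∑ m ∈ Finset.Icc 1 M, ((bernoulli (2 * m) : ℚ) : ℂ) / ((2 * m).factorial : ℂ) *
          (G (2 * m - 1) (K : ℝ) - G (2 * m - 1) 0)‖ ≤
      K * (4 / (2 * Real.pi) ^ (2 * M) * C) := by
  have hint (a b : ℝ) : IntervalIntegrable (G 0) MeasureTheory.volume a b :=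
    (continuous_iff_continuousAt.2 fun t => (hG 0 t).continuousAt).intervalIntegrable a b
  induction K with
  | zero => simp
  | succ K ih =>
    have ih := ih fun t ht => hC t ⟨ht.1, ht.2.trans (by simp)⟩
    have hunit := euler_maclaurin_unit_interval (fun k t => G k (K + t))
      (fun k t => (hG k (K + t)).comp_const_add (K : ℝ) t) M hM
    have hrem : ‖∫ t in (0 : ℝ)..1,
        ((bernoulliFun (2 * M) t / (2 * M).factorial : ℝ) : ℂ) * G (2 * M) (K + t)‖ ≤
        4 / (2 * Real.pi) ^ (2 * M) * C := by
      refine (intervalIntegral.norm_integral_le_of_norm_le_const fun t ht => ?_).trans_eq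
        (by rw [sub_zero, abs_one, mul_one])
      rw [Set.uIoc_of_le zero_le_one] at ht
      rw [norm_mul, Complex.norm_real, Real.norm_eq_abs]
      refine mul_le_mul (abs_bernoulliFun_div_factorial_le hM ⟨ht.1.le, ht.2⟩)
        (hC _ ⟨by have := ht.1; positivity, ?_⟩) (norm_nonneg _) (by positivity)
      push_cast
      linarith [ht.2]
    rw [intervalIntegral.integral_comp_add_left (G 0) (K : ℝ)] at hunit
    simp only [add_zero] at hunit
    rw [← norm_neg, ← hunit] at hrem
    refine (norm_add_le_of_le ih hrem).trans' (le_of_eq ?_) |>.trans_eq (by push_cast; ring)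
    rw [Finset.sum_range_succ _ (K + 1),
      ← intervalIntegral.integral_add_adjacent_intervals (hint 0 K) (hint K (K + 1 : ℕ))]
    simp only [mul_sub, Finset.sum_sub_distrib]
    push_cast
    congr 1
    ring

/-- A Stirling-type upper bound: `m! ≤ e m (m/e)^m`. -/
theorem factorial_mul_exp_le (m : ℕ) (hm : m ≠ 0) :
    (m.factorial : ℝ) * Real.exp m ≤ Real.exp 1 * m * (m : ℝ) ^ m := by
  induction m with
  | zero => exact absurd rfl hm
  | succ m ih =>
    rcases Nat.eq_zero_or_pos m with rfl | hpos
    · simp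
    have ih := ih hpos.ne'
    have hm0 : (0 : ℝ) < m := by exact_mod_cast hpos
    have hexp : (m : ℝ) / (m + 1) ≤ Real.exp (-(1 / (m + 1))) := by
      refine (Real.one_sub_le_exp_neg _).trans' (le_of_eq ?_)
      field_simp
      ring
    have hpow : ((m : ℝ) / (m + 1)) ^ (m + 1) ≤ Real.exp (-1) := by
      refine (pow_le_pow_left₀ (by positivity) hexp _).trans_eq ?_
      rw [← Real.exp_nat_mul]
      congr 1
      push_cast
      field_simp
    rw [div_pow, div_le_iff₀ (by positivity), Real.exp_neg, inv_mul_eq_div,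
      le_div_iff₀ (Real.exp_pos 1)] at hpow
    rw [Nat.factorial_succ]
    push_cast
    rw [Real.exp_add]
    calc ((m : ℝ) + 1) * m.factorial * (Real.exp m * Real.exp 1)
        = (m + 1) * Real.exp 1 * (m.factorial * Real.exp m) := by ring
      _ ≤ (m + 1) * Real.exp 1 * (Real.exp 1 * m * (m : ℝ) ^ m) := by gcongr
      _ = Real.exp 1 * (m + 1) * ((m : ℝ) ^ (m + 1) * Real.exp 1) := by ring
      _ ≤ Real.exp 1 * (m + 1) * ((m : ℝ) + 1) ^ (m + 1) := by gcongr

theorem iteratedDeriv_comp_ofReal_eq {F : ℂ → ℂ} (hF : ContDiff ℂ ⊤ F) (k : ℕ) :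
    iteratedDeriv k (fun t : ℝ => F t) = fun t : ℝ => iteratedDeriv k F t := by
  induction k with
  | zero => simp
  | succ k ih =>
    rw [iteratedDeriv_succ, ih]
    ext t
    rw [iteratedDeriv_succ]
    exact ((hF.differentiable_iteratedDeriv k (by simp)) t).hasDerivAt.comp_ofReal.deriv


/-- Growth of `(z/K)^j exp(2πi(c z³ + x z))` on a circle of radius `r` centred on `[0, K]`. -/
theorem norm_monomial_mul_cubic_exp_le {j K : ℕ} (hK : 0 < K) {x c y r : ℝ} (hx : |x| ≤ 3 / 4)
    (hc : |c| * (K : ℝ) ^ 2 ≤ 1 / 48) (hy : y ∈ Set.Icc (0 : ℝ) K) (hrK : r ≤ K) {z : ℂ}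
    (hz : ‖z - y‖ = r) :
    ‖z ^ j / (K : ℂ) ^ j * Complex.exp (2 * Real.pi * Complex.I * (c * z ^ 3 + x * z))‖ ≤
      Real.exp (13 * Real.pi / 8 * r + Real.pi * r ^ 2 / (6 * K) + j * r / K) := by
  have hK0 : (0 : ℝ) < K := by exact_mod_cast hK
  obtain ⟨hy0, hyK⟩ := hy
  obtain ⟨w, rfl⟩ : ∃ w : ℂ, z = y + w := ⟨z - y, by ring⟩
  rw [add_sub_cancel_left] at hz
  have hr0 : 0 ≤ r := hz ▸ norm_nonneg w
  have hpow : ‖((y : ℂ) + w) ^ j / (K : ℂ) ^ j‖ ≤ Real.exp (j * r / K) := by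
    rw [← div_pow, norm_pow, norm_div, Complex.norm_natCast, mul_div_assoc, Real.exp_nat_mul]
    refine pow_le_pow_left₀ (by positivity) ?_ j
    refine (Real.add_one_le_exp _).trans' ?_
    rw [div_le_iff₀ hK0, add_mul, div_mul_cancel₀ _ hK0.ne', one_mul, ← hz]
    refine (norm_add_le _ _).trans ?_
    rw [Complex.norm_real, Real.norm_eq_abs, abs_of_nonneg hy0]
    linarith
  have hcy : |c| * y ^ 2 ≤ 1 / 48 :=
    hc.trans' (mul_le_mul_of_nonneg_left (pow_le_pow_left₀ hy0 hyK 2) (abs_nonneg c))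
  have hcK : |c| * K ≤ 1 / (48 * K) := by
    rw [le_div_iff₀ (by positivity)]
    linarith
  have hlin : ‖((3 * c * y ^ 2 + x : ℝ) : ℂ) * w‖ ≤ 13 / 16 * r := by
    rw [norm_mul, hz, Complex.norm_real, Real.norm_eq_abs]
    refine mul_le_mul_of_nonneg_right ((abs_add_le _ _).trans ?_) hr0
    rw [abs_mul, abs_mul, abs_of_pos (by norm_num : (0 : ℝ) < 3), abs_of_nonneg (sq_nonneg y)]
    linarith
  have hquad : ‖((3 * c * y : ℝ) : ℂ) * w ^ 2‖ ≤ 3 * (1 / (48 * K)) * r ^ 2 := by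
    rw [norm_mul, norm_pow, hz, Complex.norm_real, Real.norm_eq_abs]
    refine mul_le_mul_of_nonneg_right ?_ (sq_nonneg r)
    rw [abs_mul, abs_mul, abs_of_pos (by norm_num : (0 : ℝ) < 3), abs_of_nonneg hy0]
    linarith [mul_le_mul_of_nonneg_left hyK (abs_nonneg c)]
  have hcub : ‖(c : ℂ) * w ^ 3‖ ≤ 1 / (48 * K) * r ^ 2 := by
    rw [norm_mul, norm_pow, hz, Complex.norm_real, Real.norm_eq_abs, pow_succ' r, ← mul_assoc]
    refine mul_le_mul_of_nonneg_right ?_ (sq_nonneg r)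
    linarith [mul_le_mul_of_nonneg_left hrK (abs_nonneg c)]
  have him : |((c : ℂ) * (y + w) ^ 3 + x * (y + w)).im| ≤ 13 / 16 * r + r ^ 2 / (12 * K) := by
    have hsplit : (c : ℂ) * (y + w) ^ 3 + x * (y + w) = ((c * y ^ 3 + x * y : ℝ) : ℂ) +
        (((3 * c * y ^ 2 + x : ℝ) : ℂ) * w + ((3 * c * y : ℝ) : ℂ) * w ^ 2 + (c : ℂ) * w ^ 3) := by
      push_cast
      ring
    rw [hsplit, Complex.add_im, Complex.ofReal_im, zero_add]
    refine (Complex.abs_im_le_norm _).trans ((norm_add₃_le).trans ?_)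
    have : r ^ 2 / (12 * K) = 3 * (1 / (48 * K)) * r ^ 2 + 1 / (48 * K) * r ^ 2 := by
      field_simp
      ring
    linarith
  have hre : (2 * Real.pi * Complex.I * ((c : ℂ) * (y + w) ^ 3 + x * (y + w))).re ≤
      13 * Real.pi / 8 * r + Real.pi * r ^ 2 / (6 * K) := by
    rw [mul_right_comm, ← Complex.ofReal_ofNat, ← Complex.ofReal_mul, mul_assoc,
      mul_comm _ Complex.I, Complex.re_ofReal_mul, Complex.I_mul_re]
    refine (mul_le_mul_of_nonneg_left ((neg_le_abs _).trans him) (by positivity)).trans_eq ?_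
    field_simp
    ring
  rw [norm_mul, Complex.norm_exp, Real.exp_add, mul_comm]
  exact mul_le_mul (Real.exp_le_exp.2 hre) hpow (norm_nonneg _) (Real.exp_pos _).le

/-- Lemma 5.2 (second assertion): with `M = ⌈8 log(K/ε)⌉` correction terms, the
Euler–Maclaurin remainder for `f(y) = (y^j/K^j)·exp(2πi c y³ + 2πi x y)` is `< ε`,
provided `K > Λ(K,j,ε) = 50⁴((j+1)log(K/ε))⁶`, `|x| ≤ 3/4` and `|c|K² ≤ 1/48`. -/
theorem euler_maclaurin_cubic_remainder_small (ε : ℝ) (hε0 : 0 < ε)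
    (hε1 : ε < Real.exp (-1)) (j K : ℕ)
    (hK : 50 ^ 4 * (((j : ℝ) + 1) * Real.log ((K : ℝ) / ε)) ^ 6 < (K : ℝ))
    (x c : ℝ) (hx : |x| ≤ 3 / 4) (hc : |c| * (K : ℝ) ^ 2 ≤ 1 / 48)
    (M : ℕ) (hM : M = ⌈8 * Real.log ((K : ℝ) / ε)⌉₊)
    (f : ℝ → ℂ)
    (hf : f = fun y : ℝ => (y : ℂ) ^ j / (K : ℂ) ^ j *
      Complex.exp (2 * Real.pi * Complex.I * ((c * y ^ 3 + x * y : ℝ) : ℂ))) :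
    ‖(∑ n ∈ Finset.range (K + 1), f n) - (∫ y in (0 : ℝ)..(K : ℝ), f y) -
        (f (K : ℝ) + f 0) / 2 -
        ∑ m ∈ Finset.Icc 1 M,
          ((bernoulli (2 * m) : ℚ) : ℂ) / ((2 * m).factorial : ℂ) *
            (iteratedDeriv (2 * m - 1) f (K : ℝ) - iteratedDeriv (2 * m - 1) f 0)‖ < ε := by
  have hK0 : (0 : ℝ) < K := hK.trans_le' (by positivity)
  have hKnat : 0 < K := by exact_mod_cast hK0
  have hK1 : (1 : ℝ) ≤ K := by exact_mod_cast hKnat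
  set L := Real.log (K / ε) with hL
  have hL1 : 1 ≤ L := by
    rw [hL, Real.le_log_iff_exp_le (by positivity), le_div_iff₀ hε0]
    have h := mul_le_mul_of_nonneg_left hε1.le (Real.exp_pos 1).le
    rw [← Real.exp_add, add_neg_cancel, Real.exp_zero] at h
    exact h.trans hK1
  have hjL : 1 ≤ ((j : ℝ) + 1) * L := one_le_mul_of_one_le_of_one_le (by simp) hL1
  have hLjL : L ≤ ((j : ℝ) + 1) * L := le_mul_of_one_le_left (by linarith) (by simp)
  have hKsq : 50 ^ 4 * (((j : ℝ) + 1) * L) ^ 2 < K :=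
    hK.trans_le' (by gcongr; norm_num)
  have hKlin : 50 ^ 4 * (((j : ℝ) + 1) * L) < K := hKsq.trans_le' (by gcongr; nlinarith)
  have hKL2 : 50 ^ 4 * L ^ 2 < K := hKsq.trans_le' (by gcongr)
  have hKL : 50 ^ 4 * L < K := hKlin.trans_le' (by gcongr)
  have hML : 8 * L ≤ M := hM ▸ Nat.le_ceil _
  have hMU : (M : ℝ) < 8 * L + 1 := hM ▸ Nat.ceil_lt_add_one (by linarith)
  have hM0 : M ≠ 0 := by
    rintro rfl
    norm_num at hML
    linarith
  set F : ℂ → ℂ := fun z => z ^ j / (K : ℂ) ^ j *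
    Complex.exp (2 * Real.pi * Complex.I * (c * z ^ 3 + x * z)) with hF
  have hFsmooth : ContDiff ℂ ⊤ F := by
    rw [hF]
    fun_prop
  have hfF : f = fun y : ℝ => F y := by
    rw [hf, hF]
    push_cast
    rfl
  set m := 2 * M with hm
  have hmM : (m : ℝ) = 2 * M := by rw [hm]; push_cast; ring
  have hm0 : (0 : ℝ) < m := by linarith
  set r : ℝ := 8 * m / (13 * Real.pi) with hr
  have hpi := Real.pi_pos
  have hr0 : 0 < r := by positivity
  have hrL : r ≤ 4 * L := by
    rw [hr, div_le_iff₀ (by positivity)]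
    nlinarith [Real.pi_gt_three]
  have hrK : r ≤ K := by linarith
  have hbound : ∀ t ∈ Set.Icc (0 : ℝ) K,
      ‖iteratedDeriv m f t‖ ≤ m.factorial * Real.exp (m + 2) / r ^ m := by
    intro t ht
    rw [hfF, iteratedDeriv_comp_ofReal_eq hFsmooth]
    refine Complex.norm_iteratedDeriv_le_of_forall_mem_sphere_norm_le m hr0
      (hFsmooth.differentiable (by simp)).diffContOnCl fun z hz => ?_
    refine (norm_monomial_mul_cubic_exp_le hKnat hx hc ht hrK
      (mem_sphere_iff_norm.1 hz)).trans (Real.exp_le_exp.2 ?_)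
    have h1 : 13 * Real.pi / 8 * r = m := by
      rw [hr]
      field_simp
    have h2 : Real.pi * r ^ 2 / (6 * K) ≤ 1 := by
      rw [div_le_one (by positivity)]
      have hr2 : r ^ 2 ≤ (4 * L) ^ 2 := by gcongr
      nlinarith [mul_le_mul Real.pi_le_four hr2 (sq_nonneg r) (by norm_num)]
    have h3 : j * r / K ≤ 1 := by
      rw [div_le_one hK0]
      have : (j : ℝ) * r ≤ (j + 1) * (4 * L) := by gcongr; linarith
      linarith
    linarith
  have hderiv (k : ℕ) (t : ℝ) : HasDerivAt (iteratedDeriv k f) (iteratedDeriv (k + 1) f t) t := by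
    rw [hfF, iteratedDeriv_comp_ofReal_eq hFsmooth, iteratedDeriv_comp_ofReal_eq hFsmooth,
      iteratedDeriv_succ]
    exact ((hFsmooth.differentiable_iteratedDeriv k (by simp)) t).hasDerivAt.comp_ofReal
  have hmain := norm_euler_maclaurin_remainder_le (fun k => iteratedDeriv k f) hderiv M K hM0 hbound
  simp only [iteratedDeriv_zero] at hmain
  refine hmain.trans_lt ?_
  have hexpL : Real.exp (-L) = ε / K := by
    rw [Real.exp_neg, hL, Real.exp_log (by positivity), inv_div]
  have hgeom : (13 / 16 : ℝ) ^ m ≤ (ε / K) ^ 3 := by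
    have h := pow_le_pow_left₀ (by norm_num) (Real.one_sub_le_exp_neg (3 / 16)) m
    norm_num at h
    refine h.trans ?_
    rw [← hexpL, ← Real.exp_nat_mul, ← Real.exp_nat_mul, Real.exp_le_exp]
    push_cast
    linarith
  have hfact := factorial_mul_exp_le m (by omega)
  have he3 : Real.exp 1 * Real.exp 2 ≤ 27 := by
    rw [← Real.exp_add, show (1 + 2 : ℝ) = (3 : ℕ) * 1 by norm_num, Real.exp_nat_mul]
    refine (pow_le_pow_left₀ (Real.exp_pos 1).le
      (Real.exp_one_lt_d9.le.trans (by norm_num : _ ≤ (3 : ℝ))) 3).trans (by norm_num)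
  have h2r : (2 * Real.pi) ^ m * r ^ m = (16 / 13) ^ m * (m : ℝ) ^ m := by
    rw [← mul_pow, ← mul_pow, hr]
    congr 1
    field_simp
    norm_num
  have hεsq : ε ^ 2 ≤ 1 := by
    have : ε ≤ 1 := hε1.le.trans (by simp)
    exact pow_le_one₀ hε0.le this
  calc (K : ℝ) * (4 / (2 * Real.pi) ^ m * (m.factorial * Real.exp (m + 2) / r ^ m))
      = 4 * K * Real.exp 2 * (m.factorial * Real.exp m) / ((2 * Real.pi) ^ m * r ^ m) := by
        rw [Real.exp_add]
        field_simp
    _ ≤ 4 * K * Real.exp 2 * (Real.exp 1 * m * (m : ℝ) ^ m) / ((2 * Real.pi) ^ m * r ^ m) := by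
        gcongr
    _ = 4 * K * (Real.exp 1 * Real.exp 2) * m * (13 / 16 : ℝ) ^ m := by
        rw [h2r, div_pow, div_pow]
        field_simp
    _ ≤ 4 * K * 27 * (18 * L) * (ε / K) ^ 3 := by
        gcongr
        linarith
    _ = 1944 * L * ε ^ 2 / K ^ 2 * ε := by
        field_simp
        ring
    _ < 1 * ε := by
        gcongr
        rw [div_lt_one (by positivity)]
        nlinarith
    _ = ε := one_mul ε
end
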